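/- arXiv:1802.03218 — 3 statements merged into one kernel-verified Lean document; each statement's English description precedes it below -/
import Mathlib

section
/- Let 0 < λ ≤ Λ and N ≥ 2 an integer with Ñ := (λ/Λ)(N−1) + 1 > 2. Assume: (a) there exists a normalized fast-decaying entire solution U at exponent p⋆ > 1, with inflection radius R₀ > 0; (b) the Dirichlet problem in the unit ball with exponent p⋆ has no positive radial solution. Let εₙ → 0⁺ with pₙ := p⋆ − εₙ > 1, and let uₙ be positive radial solutions of the Dirichlet problem with exponent pₙ having a unique inflection radius r₀(n) ∈ (0,1). Set γₙ := 2(pₙ+1)/(pₙ−1) − N and gₙ(x) := r₀(n)^{γₙ} if |x| ≤ r₀(n), gₙ(x) := |x|^{γₙ} if |x| > r₀(n); set γ⋆ := 2(p⋆+1)/(p⋆−1) − N and g_U(x) := R₀^{γ⋆} if |x| ≤ R₀, g_U(x) := |x|^{γ⋆} if |x| > R₀. Then ∫_{ℝ^N} U(|x|)^{p⋆+1}·g_U(x) dx is finite, and ∫_{B₁(0)} uₙ(|x|)^{pₙ+1}·gₙ(x) dx → ∫_{ℝ^N} U(|x|)^{p⋆+1}·g_U(x) dx as n → ∞. -/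
open Real Filter Set

/-- The radial Pucci maximal operator `M⁺_{λ,Λ}` applied to a radial C² function `u`
of the radial variable `r`. -/
noncomputable def radialPucci (lam Lam : ℝ) (N : ℕ) (u : ℝ → ℝ) (r : ℝ) : ℝ :=
  Lam * max (deriv (deriv u) r) 0 + lam * min (deriv (deriv u) r) 0 +
    ((N : ℝ) - 1) * (Lam * max (deriv u r / r) 0 + lam * min (deriv u r / r) 0)

/-- A positive radial solution of the Dirichlet problem `-M⁺[u] = u^q` in the unit ball. -/
def IsDirichletSol (lam Lam : ℝ) (N : ℕ) (q : ℝ) (u : ℝ → ℝ) : Prop :=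
  ContDiffOn ℝ 2 u (Set.Icc 0 1) ∧
    (∀ r ∈ Set.Ico (0 : ℝ) 1, 0 < u r) ∧
    u 1 = 0 ∧ deriv u 0 = 0 ∧
    (∀ r ∈ Set.Icc (0 : ℝ) 1, deriv u r ≤ 0) ∧
    (∀ r ∈ Set.Ioo (0 : ℝ) 1, -radialPucci lam Lam N u r = u r ^ q)

/-- `r0 ∈ (0,1)` is the (unique) inflection radius of `u` in the unit ball. -/
def InflectionAt (u : ℝ → ℝ) (r0 : ℝ) : Prop :=
  r0 ∈ Set.Ioo (0 : ℝ) 1 ∧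
    (∀ r ∈ Set.Ico (0 : ℝ) r0, deriv (deriv u) r < 0) ∧
    deriv (deriv u) r0 = 0 ∧
    (∀ r ∈ Set.Ioo r0 (1 : ℝ), 0 < deriv (deriv u) r)

/-- A normalized fast-decaying entire radial solution of `-M⁺[U] = U^{p⋆}` in `ℝ^N`,
with fast-decay constant `c1` and inflection radius `R0`. -/
def IsEntireSol (lam Lam : ℝ) (N : ℕ) (Ntil pstar c1 R0 : ℝ) (U : ℝ → ℝ) : Prop :=
  ContDiffOn ℝ 2 U (Set.Ici 0) ∧
    (∀ r : ℝ, 0 ≤ r → 0 < U r) ∧ U 0 = 1 ∧ deriv U 0 = 0 ∧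
    (∀ r : ℝ, 0 < r → deriv U r < 0) ∧
    (∀ r : ℝ, 0 < r → -radialPucci lam Lam N U r = U r ^ pstar) ∧
    0 < R0 ∧
    (∀ r ∈ Set.Ico (0 : ℝ) R0, deriv (deriv U) r < 0) ∧
    deriv (deriv U) R0 = 0 ∧
    (∀ r : ℝ, R0 < r → 0 < deriv (deriv U) r) ∧
    0 < c1 ∧
    Filter.Tendsto (fun r : ℝ => r ^ (Ntil - 2) * U r) Filter.atTop (nhds c1) ∧
    Filter.Tendsto (fun r : ℝ => r ^ (Ntil - 1) * deriv U r) Filter.atTop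
      (nhds (-(Ntil - 2) * c1))

/-- The decreasing branch of the radial equation on `[0, R)`, with first and second derivatives
`v1`, `v2`, normalized by `v 0 = 1`, and with a single inflection radius `ρ`. -/
structure RadialProfile (lam Lam c p R ρ : ℝ) (v v1 v2 : ℝ → ℝ) : Prop where
  rho_pos : 0 < ρ
  rho_lt : ρ < R
  cont : ContinuousOn v (Icc 0 R)
  cont_deriv : ContinuousOn v1 (Ico 0 R)
  hasDerivAt : ∀ r ∈ Ioo 0 R, HasDerivAt v (v1 r) r
  hasDerivAt_deriv : ∀ r ∈ Ioo 0 R, HasDerivAt v1 (v2 r) r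
  zero : v 0 = 1
  deriv_zero : v1 0 = 0
  pos : ∀ r ∈ Ico 0 R, 0 < v r
  deriv_neg : ∀ r ∈ Ioo 0 R, v1 r < 0
  eqn : ∀ r ∈ Ioo 0 R,
    Lam * max (v2 r) 0 + lam * min (v2 r) 0 + c * lam * (v1 r / r) = -(v r) ^ p
  concave : ∀ r ∈ Ioo 0 ρ, v2 r < 0
  convex : ∀ r ∈ Ioo ρ R, 0 < v2 r

lemma exists_first_hit {f : ℝ → ℝ} {a c L : ℝ} (hac : a ≤ c) (hf : ContinuousOn f (Icc a c))
    (ha : f a < L) (hc : L ≤ f c) :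
    ∃ τ ∈ Ioc a c, f τ = L ∧ ∀ s ∈ Ico a τ, f s < L := by
  have hne : (Icc a c ∩ f ⁻¹' Ici L).Nonempty := ⟨c, ⟨hac, le_rfl⟩, hc⟩
  have hcl : IsClosed (Icc a c ∩ f ⁻¹' Ici L) :=
    hf.preimage_isClosed_of_isClosed isClosed_Icc isClosed_Ici
  have hbd : BddBelow (Icc a c ∩ f ⁻¹' Ici L) := ⟨a, fun x hx => hx.1.1⟩
  set τ := sInf (Icc a c ∩ f ⁻¹' Ici L) with hτ
  have hmem : τ ∈ Icc a c ∩ f ⁻¹' Ici L := hcl.csInf_mem hne hbd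
  have hlt : ∀ s ∈ Ico a τ, f s < L := by
    intro s hs
    by_contra! h
    exact absurd (csInf_le hbd ⟨⟨hs.1, hs.2.le.trans hmem.1.2⟩, h⟩) (not_le.2 hs.2)
  have haτ : a < τ := by
    rcases hmem.1.1.lt_or_eq with h | h
    · exact h
    · have := hmem.2
      rw [← h] at this
      exact absurd this (not_le.2 ha)
  refine ⟨τ, ⟨haτ, hmem.1.2⟩, le_antisymm ?_ hmem.2, hlt⟩
  by_contra! h
  obtain ⟨s, hs, hfs⟩ := intermediate_value_Icc haτ.le
    (hf.mono (Icc_subset_Icc_right hmem.1.2)) ⟨ha.le, h.le⟩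
  have hsτ : s < τ := by
    rcases hs.2.lt_or_eq with h' | h'
    · exact h'
    · rw [h'] at hfs
      exact absurd hfs h.ne'
  exact absurd (hlt s ⟨hs.1, hsτ⟩) (by simp [hfs])

lemma HasDerivAt.nonneg_of_le_left {f : ℝ → ℝ} {a τ f' : ℝ} (hf : HasDerivAt f f' τ) (haτ : a < τ)
    (h : ∀ s ∈ Ioo a τ, f s ≤ f τ) : 0 ≤ f' := by
  have h1 := (hasDerivAt_iff_tendsto_slope.1 hf).mono_left
    (nhdsWithin_mono τ (fun x (hx : x ∈ Iio τ) => hx.ne) : nhdsWithin τ (Iio τ) ≤ _)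
  refine ge_of_tendsto h1 ?_
  filter_upwards [Ioo_mem_nhdsLT haτ] with s hs
  rw [slope_def_field]
  exact div_nonneg_of_nonpos (by linarith [h s hs]) (by linarith [hs.2])

lemma antitoneOn_Ico_of_hasDerivAt {f f' : ℝ → ℝ} {a b : ℝ}
    (hf : ∀ r ∈ Ico a b, HasDerivAt f (f' r) r) (hf' : ∀ r ∈ Ico a b, f' r ≤ 0) :
    AntitoneOn f (Ico a b) := by
  refine antitoneOn_of_hasDerivWithinAt_nonpos (convex_Ico a b)
    (fun r hr => (hf r hr).continuousAt.continuousWithinAt)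
    (fun r hr => (hf r (interior_subset hr)).hasDerivWithinAt)
    (fun r hr => hf' r (interior_subset hr))

/-- Phase-plane barrier: a trajectory of the Lotka–Volterra system attached to the convex part of
a radial profile that starts below the saddle `(D, 0)` and close to the axis `Y = 0` stays
below the saddle as long as `Y < D + 1`. -/
lemma exists_barrier {D P b b2 : ℝ} (hb : 0 < b) (hbb : b < b2) (hb2 : b2 < D) (hP : 1 < P) :
    ∃ δ > 0, ∀ (p a R : ℝ) (X Y : ℝ → ℝ), 1 < p → p ≤ P → 0 < a →
      (∀ r ∈ Ico a R, 0 < X r) → (∀ r ∈ Ico a R, 0 < Y r) → (∀ r ∈ Ico a R, Y r < D + 1) →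
      (∀ r ∈ Ico a R, HasDerivAt X (X r * (X r + Y r - D) / r) r) →
      (∀ r ∈ Ico a R, HasDerivAt Y (Y r * (D + 2 - p * X r - Y r) / r) r) →
      X a = b → X a * Y a ≤ δ → ∀ r ∈ Ico a R, X r < b2 := by
  have hD : 0 < D := by linarith
  have hd : 0 < D - b2 := by linarith
  obtain ⟨m, hm⟩ : ∃ m, m = (D - b2) / (4 * (D + 2)) := ⟨_, rfl⟩
  have hm0 : 0 < m := by rw [hm]; positivity
  have hmD : m * (D + 2) = (D - b2) / 4 := by rw [hm]; field_simp
  have hq : 0 < 1 + 2 * P * b2 := by nlinarith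
  obtain ⟨y, hy⟩ : ∃ y, y = (D - b2) / (4 * (1 + 2 * P * b2)) := ⟨_, rfl⟩
  have hy0 : 0 < y := by rw [hy]; positivity
  have hyq : y * (1 + 2 * P * b2) = (D - b2) / 4 := by
    rw [hy, div_mul_eq_mul_div, mul_div_mul_right _ _ hq.ne']
  obtain ⟨x, hx0, hxP, hxD, hxb⟩ : ∃ x, 0 < x ∧ P * x ≤ 1 / 2 ∧ x ≤ D / 4 ∧ x < b2 := by
    refine ⟨min (1 / (2 * P)) (min (D / 4) b), by positivity, ?_, ?_, ?_⟩
    · calc P * min (1 / (2 * P)) (min (D / 4) b) ≤ P * (1 / (2 * P)) := by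
            gcongr; exact min_le_left _ _
        _ = 1 / 2 := by field_simp
    · exact (min_le_right _ _).trans (min_le_left _ _)
    · exact ((min_le_right _ _).trans (min_le_right _ _)).trans_lt hbb
  obtain ⟨F0, hF0⟩ : ∃ F0, F0 = log x + m * log y - 2 * (D + 1) := ⟨_, rfl⟩
  refine ⟨b * exp ((F0 - log b) / m), by positivity, ?_⟩
  intro p a R X Y hp hpP ha hX hY hYD hX' hY' hXa hZa
  by_contra! hcon
  obtain ⟨c, hc, hXc⟩ := hcon
  have hsub : Icc a c ⊆ Ico a R := fun s hs => ⟨hs.1, hs.2.trans_lt hc.2⟩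
  obtain ⟨τ, hτ, hXτ, hlt⟩ := exists_first_hit hc.1
    (fun s hs => (hX' s (hsub hs)).continuousAt.continuousWithinAt) (by rw [hXa]; exact hbb) hXc
  have hsubτ : Icc a τ ⊆ Ico a R := fun s hs => hsub ⟨hs.1, hs.2.trans hτ.2⟩
  have hXle : ∀ s ∈ Icc a τ, X s ≤ b2 := fun s hs => by
    rcases hs.2.lt_or_eq with h | h
    · exact (hlt s ⟨hs.1, h⟩).le
    · rw [h, hXτ]
  -- where the Lyapunov function is below its initial bound, `Y` is small or `X` is small
  have hdich : ∀ s ∈ Icc a τ, log (X s) + m * log (Y s) - 2 * Y s ≤ F0 → y < Y s → X s ≤ x := by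
    intro s hs hF hys
    have h1 : log y ≤ log (Y s) := log_le_log hy0 hys.le
    have h2 := hYD s (hsubτ hs)
    have h3 : m * log y ≤ m * log (Y s) := by gcongr
    exact (log_le_log_iff (hX s (hsubτ hs)) hx0).1 (by linarith)
  have hF' : ∀ s ∈ Icc a τ, HasDerivAt (fun s => log (X s) + m * log (Y s) - 2 * Y s)
      ((X s + Y s - D + m * (D + 2 - p * X s - Y s) -
        2 * Y s * (D + 2 - p * X s - Y s)) / s) s := by
    intro s hs
    have hs' := hsubτ hs
    have h1 := (hX' s hs').log (hX s hs').ne'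
    have h2 := ((hY' s hs').log (hY s hs').ne').const_mul m
    have h3 := (hY' s hs').const_mul 2
    refine ((h1.add h2).sub h3).congr_deriv ?_
    have := hX s hs'
    have := hY s hs'
    have : 0 < s := ha.trans_le hs.1
    field_simp
  have hFle : ∀ s ∈ Icc a τ, log (X s) + m * log (Y s) - 2 * Y s ≤ F0 := by
    intro s hs
    refine image_le_of_deriv_right_lt_deriv_boundary'
      (f := fun s => log (X s) + m * log (Y s) - 2 * Y s) (B := fun _ => F0) (B' := fun _ => 0)
      (fun s hs => (hF' s hs).continuousAt.continuousWithinAt)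
      (fun s hs => (hF' s (Ico_subset_Icc_self hs)).hasDerivWithinAt) ?_ continuousOn_const
      (fun s _ => hasDerivWithinAt_const _ _ _) ?_ hs
    · have haR : a ∈ Ico a R := hsubτ ⟨le_rfl, hτ.1.le⟩
      have h1 := hY a haR
      have h2 : Y a ≤ exp ((F0 - log b) / m) := by
        rw [hXa] at hZa
        exact le_of_mul_le_mul_left hZa hb
      have h3 : log (Y a) ≤ (F0 - log b) / m := by
        rw [← log_exp ((F0 - log b) / m)]
        exact log_le_log h1 h2
      have h4 : m * log (Y a) ≤ F0 - log b := by
        rwa [le_div_iff₀' hm0] at h3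
      simp only [hXa]
      linarith
    · intro s hs hFs
      have hs' := Ico_subset_Icc_self hs
      have hXs := hX s (hsubτ hs')
      have hYs := hY s (hsubτ hs')
      have hYDs := hYD s (hsubτ hs')
      have hXb := hXle s hs'
      have hs0 : 0 < s := ha.trans_le hs.1
      refine div_neg_of_neg_of_pos ?_ hs0
      have hpX : 0 < p * X s := by positivity
      have hmX : m * (D + 2 - p * X s - Y s) ≤ (D - b2) / 4 := by
        rw [← hmD]; gcongr; linarith
      rcases le_or_gt (Y s) y with h | h
      · have h1 : p * X s ≤ P * b2 := by gcongr
        have h2 : Y s * (p * X s) ≤ y * (P * b2) := by gcongr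
        nlinarith
      · have h1 := hdich s hs' hFs.le h
        have h2 : p * X s ≤ P * x := by gcongr
        nlinarith
  have hτm : τ ∈ Icc a τ := ⟨hτ.1.le, le_rfl⟩
  have hYτ : Y τ ≤ y := by
    by_contra! h
    linarith [hdich τ hτm (hFle τ hτm) h]
  have h1 := (hX' τ (hsubτ hτm)).nonneg_of_le_left hτ.1
    (fun s hs => by rw [hXτ]; exact (hlt s ⟨hs.1.le, hs.2⟩).le)
  have h2 : X τ * (X τ + Y τ - D) / τ < 0 := by
    refine div_neg_of_neg_of_pos (mul_neg_of_pos_of_neg (hX τ (hsubτ hτm)) ?_) (ha.trans hτ.1)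
    have : y ≤ (D - b2) / 4 := by
      rw [← hyq]
      nlinarith [mul_pos hy0 (mul_pos (show 0 < P by linarith) (show 0 < b2 by linarith))]
    linarith
  linarith

lemma RadialProfile.convex_eqn {lam Lam c p R ρ D : ℝ} {v v1 v2 : ℝ → ℝ}
    (h : RadialProfile lam Lam c p R ρ v v1 v2) (hLam : 0 < Lam) (hD : lam / Lam * c = D + 1) :
    ∀ r ∈ Ioo ρ R, v2 r = -(D + 1) * v1 r / r - v r ^ p / Lam := by
  intro r hr
  have hr0 : 0 < r := h.rho_pos.trans hr.1
  have h1 := h.eqn r ⟨hr0, hr.2⟩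
  rw [max_eq_left (h.convex r hr).le, min_eq_right (h.convex r hr).le] at h1
  have h2 : c * lam = Lam * (D + 1) := by rw [← hD]; field_simp
  rw [h2] at h1
  have h3 : Lam * v2 r = -(Lam * (D + 1) * (v1 r / r)) - v r ^ p := by linarith
  have h4 : v2 r = (-(Lam * (D + 1) * (v1 r / r)) - v r ^ p) / Lam := by
    rw [← h3]; field_simp
  rw [h4]
  field_simp

/-- Uniform tail decay: once `-r v'/v` exceeds `b` at a point `S` where `r² v^(p-1)` is small
enough, it does so up to the first zero of `v`. -/
lemma exists_tail_bound {lam Lam c D P b b2 : ℝ} (hLam : 0 < Lam)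
    (hD : lam / Lam * c = D + 1) (hb : 0 < b) (hbb : b < b2) (hb2 : b2 < D) (hP : 1 < P) :
    ∃ δ > 0, ∀ (p R ρ S : ℝ) (v v1 v2 : ℝ → ℝ), RadialProfile lam Lam c p R ρ v v1 v2 →
      v R = 0 → 1 < p → p ≤ P → 2 ≤ (p - 1) * b → ρ < S → S < R →
      b < -S * v1 S / v S → (-S * v1 S / v S) * (-S * v S ^ p / (Lam * v1 S)) ≤ δ →
      ∀ r ∈ Ico S R, v r * r ^ b ≤ v S * S ^ b := by
  obtain ⟨δ, hδ, H⟩ := exists_barrier hb hbb hb2 hP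
  refine ⟨δ, hδ, ?_⟩
  intro p R ρ S v v1 v2 h hvR hp hpP hpb hρS hSR hXS hZS
  have hS0 : 0 < S := h.rho_pos.trans hρS
  have hpos : ∀ r ∈ Ico S R, 0 < r := fun r hr => hS0.trans_le hr.1
  have hIoo : ∀ r ∈ Ico S R, r ∈ Ioo 0 R := fun r hr => ⟨hpos r hr, hr.2⟩
  have hv : ∀ r ∈ Ico S R, 0 < v r := fun r hr => h.pos r ⟨(hpos r hr).le, hr.2⟩
  have hv1 : ∀ r ∈ Ico S R, v1 r < 0 := fun r hr => h.deriv_neg r (hIoo r hr)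
  have hv2 := h.convex_eqn hLam hD
  obtain ⟨X, hX⟩ : ∃ X : ℝ → ℝ, X = fun r => -r * v1 r / v r := ⟨_, rfl⟩
  obtain ⟨Y, hY⟩ : ∃ Y : ℝ → ℝ, Y = fun r => -r * v r ^ p / (Lam * v1 r) := ⟨_, rfl⟩
  have hXpos : ∀ r ∈ Ico S R, 0 < X r := fun r hr => by
    rw [hX]; exact div_pos (by nlinarith [hpos r hr, hv1 r hr]) (hv r hr)
  have hYpos : ∀ r ∈ Ico S R, 0 < Y r := fun r hr => by
    rw [hY]
    have := rpow_pos_of_pos (hv r hr) p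
    exact div_pos_of_neg_of_neg (by nlinarith [mul_pos (hpos r hr) this])
      (mul_neg_of_pos_of_neg hLam (hv1 r hr))
  have hYD : ∀ r ∈ Ico S R, Y r < D + 1 := fun r hr => by
    have h1 := h.convex r ⟨hρS.trans_le hr.1, hr.2⟩
    rw [hv2 r ⟨hρS.trans_le hr.1, hr.2⟩] at h1
    have h2 := hpos r hr
    rw [hY]
    simp only
    rw [div_lt_iff_of_neg (mul_neg_of_pos_of_neg hLam (hv1 r hr))]
    have h3 : 0 < (-(D + 1) * v1 r / r - v r ^ p / Lam) * (r * Lam) := by positivity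
    have h4 : (-(D + 1) * v1 r / r - v r ^ p / Lam) * (r * Lam) =
      -(D + 1) * v1 r * Lam - v r ^ p * r := by field_simp
    linarith
  have hX' : ∀ r ∈ Ico S R, HasDerivAt X (X r * (X r + Y r - D) / r) r := fun r hr => by
    have h1 := ((hasDerivAt_id r).neg.mul (h.hasDerivAt_deriv r (hIoo r hr))).div
      (h.hasDerivAt r (hIoo r hr)) (hv r hr).ne'
    rw [hX]
    refine h1.congr_deriv ?_
    rw [hv2 r ⟨hρS.trans_le hr.1, hr.2⟩, hY]
    have := (hv r hr).ne'
    have := (hv1 r hr).ne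
    have := (hpos r hr).ne'
    simp only [id, Pi.neg_apply, Pi.mul_apply]
    field_simp
    ring
  have hY' : ∀ r ∈ Ico S R, HasDerivAt Y (Y r * (D + 2 - p * X r - Y r) / r) r := fun r hr => by
    have h1 := ((hasDerivAt_id r).neg.mul ((h.hasDerivAt r (hIoo r hr)).rpow_const
      (Or.inl (hv r hr).ne') (p := p))).div
      ((h.hasDerivAt_deriv r (hIoo r hr)).const_mul Lam)
      (mul_neg_of_pos_of_neg hLam (hv1 r hr)).ne
    rw [hY]
    refine h1.congr_deriv ?_
    rw [hv2 r ⟨hρS.trans_le hr.1, hr.2⟩, hX, rpow_sub_one (hv r hr).ne']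
    have := (hv r hr).ne'
    have := (hv1 r hr).ne
    have := (hpos r hr).ne'
    simp only [id, Pi.neg_apply, Pi.mul_apply]
    field_simp
    ring
  have hvX : ∀ r ∈ Ico S R, r * v1 r = -(X r * v r) := fun r hr => by
    have := (hv r hr).ne'
    rw [hX]; field_simp
  have hmono : ∀ β : ℝ, ∀ r ∈ Ico S R, HasDerivAt (fun r => v r * r ^ β)
      ((β - X r) * v r * r ^ β / r) r := fun β r hr => by
    refine ((h.hasDerivAt r (hIoo r hr)).mul
      (hasDerivAt_rpow_const (p := β) (Or.inl (hpos r hr).ne'))).congr_deriv ?_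
    rw [rpow_sub_one (hpos r hr).ne']
    have h0 := (hpos r hr).ne'
    rw [eq_div_iff h0]
    have h1 := hvX r hr
    field_simp
    linear_combination r ^ β * h1
  have hXb : ∀ r ∈ Ico S R, b ≤ X r := by
    by_contra! hcon
    obtain ⟨r', hr', hXr'⟩ := hcon
    have hXS' : b < X S := by rw [hX]; exact hXS
    obtain ⟨a, ha, hXa, hlt⟩ := exists_first_hit (f := fun r => -X r) (L := -b) hr'.1
      (fun s hs => (hX' s ⟨hs.1, hs.2.trans_lt hr'.2⟩).neg.continuousAt.continuousWithinAt)
      (by linarith) (by linarith)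
    have haR : a < R := ha.2.trans_lt hr'.2
    have hZ : X a * Y a ≤ X S * Y S := by
      refine antitoneOn_of_hasDerivWithinAt_nonpos (f := fun r => X r * Y r)
        (f' := fun r => X r * Y r * (2 - (p - 1) * X r) / r) (convex_Icc S a)
        (fun r hr => ?_) (fun r hr => ?_) (fun r hr => ?_)
        ⟨le_rfl, ha.1.le⟩ ⟨ha.1.le, le_rfl⟩ ha.1.le
      · exact ((hX' r ⟨hr.1, hr.2.trans_lt haR⟩).mul
          (hY' r ⟨hr.1, hr.2.trans_lt haR⟩)).continuousAt.continuousWithinAt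
      · rw [interior_Icc] at hr ⊢
        have hr2 : r ∈ Ico S R := ⟨hr.1.le, hr.2.trans haR⟩
        refine (((hX' r hr2).mul (hY' r hr2)).congr_deriv ?_).hasDerivWithinAt
        have := (hpos r hr2).ne'
        field_simp
        ring
      · rw [interior_Icc] at hr
        have hr2 : r ∈ Ico S R := ⟨hr.1.le, hr.2.trans haR⟩
        have h1 : b < X r := by linarith [hlt r ⟨hr.1.le, hr.2⟩]
        refine div_nonpos_of_nonpos_of_nonneg (mul_nonpos_of_nonneg_of_nonpos
          (mul_pos (hXpos r hr2) (hYpos r hr2)).le ?_) (hpos r hr2).le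
        have : (p - 1) * b ≤ (p - 1) * X r := by gcongr
        linarith
    have hZS' : X S * Y S ≤ δ := by rw [hX, hY]; exact hZS
    have hsub : ∀ r ∈ Ico a R, r ∈ Ico S R := fun r hr => ⟨ha.1.le.trans hr.1, hr.2⟩
    have hXb2 := H p a R X Y hp hpP (hS0.trans ha.1) (fun r hr => hXpos r (hsub r hr))
      (fun r hr => hYpos r (hsub r hr)) (fun r hr => hYD r (hsub r hr))
      (fun r hr => hX' r (hsub r hr)) (fun r hr => hY' r (hsub r hr)) (by linarith)
      (hZ.trans hZS')
    -- a bounded `X` prevents `v` from vanishing at `R`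
    have hmon : MonotoneOn (fun r => v r * r ^ b2) (Icc a R) := by
      have ha0 : 0 < a := hS0.trans ha.1
      refine monotoneOn_of_hasDerivWithinAt_nonneg (convex_Icc a R)
        ((h.cont.mono (Icc_subset_Icc_left ha0.le)).mul
          (continuousOn_id.rpow_const fun x hx => Or.inl (ha0.trans_le hx.1).ne'))
        (f' := fun r => (b2 - X r) * v r * r ^ b2 / r)
        (fun r hr => ?_) (fun r hr => ?_)
      · rw [interior_Icc] at hr ⊢
        exact (hmono b2 r (hsub r ⟨hr.1.le, hr.2⟩)).hasDerivWithinAt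
      · rw [interior_Icc] at hr
        have hr2 := hsub r ⟨hr.1.le, hr.2⟩
        have h1 := hXb2 r ⟨hr.1.le, hr.2⟩
        have h2 := hpos r hr2
        have h3 := hv r hr2
        have h4 : 0 < b2 - X r := by linarith
        positivity
    have h1 := hmon ⟨le_rfl, haR.le⟩ ⟨haR.le, le_rfl⟩ haR.le
    have h2 := mul_pos (hv a (hsub a ⟨le_rfl, haR⟩))
      (rpow_pos_of_pos (hS0.trans ha.1) b2)
    simp only [hvR, zero_mul] at h1
    linarith
  intro r hr
  refine antitoneOn_Ico_of_hasDerivAt (hmono b) (fun s hs => ?_) ⟨le_rfl, hSR⟩ hr hr.1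
  have h2 := hpos s hs
  have h3 := hv s hs
  refine div_nonpos_of_nonpos_of_nonneg (mul_nonpos_of_nonpos_of_nonneg
    (mul_nonpos_of_nonpos_of_nonneg (by linarith [hXb s hs]) h3.le) (by positivity)) h2.le

lemma RadialProfile.antitoneOn {lam Lam c p R ρ : ℝ} {v v1 v2 : ℝ → ℝ}
    (h : RadialProfile lam Lam c p R ρ v v1 v2) : AntitoneOn v (Icc 0 R) := by
  refine antitoneOn_of_hasDerivWithinAt_nonpos (convex_Icc 0 R) h.cont (f' := v1)
    (fun r hr => ?_) (fun r hr => ?_)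
  · exact (h.hasDerivAt r (by rwa [interior_Icc] at hr)).hasDerivWithinAt
  · exact (h.deriv_neg r (by rwa [interior_Icc] at hr)).le

lemma RadialProfile.le_one {lam Lam c p R ρ : ℝ} {v v1 v2 : ℝ → ℝ}
    (h : RadialProfile lam Lam c p R ρ v v1 v2) {r : ℝ} (hr : r ∈ Ico 0 R) : v r ≤ 1 := by
  rw [← h.zero]
  exact h.antitoneOn ⟨le_rfl, (hr.1.trans_lt hr.2).le⟩ (Ico_subset_Icc_self hr) hr.1

lemma abs_rpow_sub_rpow_le {p x y : ℝ} (hp : 1 < p) (hx : 0 < x) (hx1 : x ≤ 1) (hy : 0 < y)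
    (hy1 : y ≤ 1) : |x ^ p - y ^ p| ≤ p * |x - y| := by
  have := (convex_Ioc (0 : ℝ) 1).norm_image_sub_le_of_norm_hasDerivWithin_le
    (f := fun z : ℝ => z ^ p) (f' := fun z => p * z ^ (p - 1)) (C := p)
    (fun z hz => (hasDerivAt_rpow_const (Or.inl hz.1.ne')).hasDerivWithinAt)
    (fun z hz => by
      rw [norm_of_nonneg (by have := hz.1; positivity)]
      have := rpow_le_one hz.1.le hz.2 (by linarith : 0 ≤ p - 1)
      nlinarith) ⟨hy, hy1⟩ ⟨hx, hx1⟩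
  simpa using this

lemma abs_rpow_sub_rpow_exponent_le {p ε x : ℝ} (hε : 0 ≤ ε) (hp : 1 < p - ε) (hx : 0 < x)
    (hx1 : x ≤ 1) : |x ^ (p - ε) - x ^ p| ≤ ε := by
  have h1 : x ^ p ≤ x ^ (p - ε) := rpow_le_rpow_of_exponent_ge hx hx1 (by linarith)
  rw [abs_of_nonneg (by linarith)]
  have h2 : x ^ p = x ^ (p - ε) * x ^ ε := by rw [← rpow_add hx]; congr 1; ring
  have h3 : 1 + ε * log x ≤ x ^ ε := by
    rw [rpow_def_of_pos hx]
    linarith [add_one_le_exp (log x * ε)]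
  have h4 : x ^ (p - ε) ≤ x := by
    simpa using rpow_le_rpow_of_exponent_ge hx hx1 hp.le
  have h5 : 0 < x ^ (p - ε) := rpow_pos_of_pos hx _
  have h6 : -log x * x ≤ 1 := by
    have := log_le_sub_one_of_pos (inv_pos.2 hx)
    rw [log_inv] at this
    have h7 : x⁻¹ * x = 1 := inv_mul_cancel₀ hx.ne'
    nlinarith
  have h8 : 0 ≤ -log x := by linarith [log_nonpos hx.le hx1]
  have h9 : x ^ (p - ε) - x ^ p ≤ x ^ (p - ε) * (ε * -log x) := by
    rw [h2]; nlinarith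
  calc _ ≤ _ := h9
    _ ≤ x * (ε * -log x) := by gcongr
    _ = ε * (-log x * x) := by ring
    _ ≤ ε := by nlinarith

lemma exists_pucci_slope {lam Lam : ℝ} (hlL : lam ≤ Lam) (x y : ℝ) :
    ∃ θ, lam ≤ θ ∧ (Lam * max x 0 + lam * min x 0) - (Lam * max y 0 + lam * min y 0) =
      θ * (x - y) := by
  rcases eq_or_ne x y with rfl | hxy
  · exact ⟨lam, le_rfl, by simp⟩
  have hne : x - y ≠ 0 := sub_ne_zero.2 hxy
  refine ⟨lam + (Lam - lam) * ((max x 0 - max y 0) / (x - y)), ?_, ?_⟩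
  · have : 0 ≤ (max x 0 - max y 0) / (x - y) := by
      rcases lt_or_gt_of_ne hxy with h | h
      · exact div_nonneg_of_nonpos (sub_nonpos.2 (max_le_max_right 0 h.le)) (by linarith)
      · exact div_nonneg (sub_nonneg.2 (max_le_max_right 0 h.le)) (by linarith)
    nlinarith
  · have h1 : min x 0 = x - max x 0 := by linarith [min_add_max x 0]
    have h2 : min y 0 = y - max y 0 := by linarith [min_add_max y 0]
    rw [h1, h2]
    field_simp
    ring

lemma two_mul_mul_le {lam θ P ε k q w w1 Δ : ℝ} (hlam : 0 < lam) (hP : 0 < P) (hε : 0 < ε)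
    (hθ : lam ≤ θ) (hk : 0 ≤ k) (hq : |q| ≤ P * |w| + ε) (hΔ : θ * Δ = -q - k * w1) :
    2 * (w1 * Δ) ≤ (P + 1) / lam * (w ^ 2 + w1 ^ 2 + ε ^ 2) := by
  have g2 : θ * (w1 * Δ) ≤ |w1| * (P * |w| + ε) := by
    have h1 : θ * (w1 * Δ) = -w1 * q - k * w1 ^ 2 := by
      rw [mul_left_comm, hΔ]; ring
    have h2 : 0 ≤ k * w1 ^ 2 := by positivity
    have h3 : -w1 * q ≤ |w1| * |q| := by
      rw [← abs_neg w1, ← abs_mul]; exact le_abs_self _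
    have h4 : |w1| * |q| ≤ |w1| * (P * |w| + ε) := by gcongr
    linarith
  have g3 : lam * (w1 * Δ) ≤ |w1| * (P * |w| + ε) := by
    rcases le_or_gt 0 (w1 * Δ) with h | h
    · exact (mul_le_mul_of_nonneg_right hθ h).trans g2
    · exact (mul_neg_of_pos_of_neg hlam h).le.trans (by positivity)
  rw [div_mul_eq_mul_div, le_div_iff₀' hlam]
  have h1 : |w1| ^ 2 = w1 ^ 2 := sq_abs _
  have h2 : |w| ^ 2 = w ^ 2 := sq_abs _
  have h3 : 2 * (|w1| * |w|) ≤ w1 ^ 2 + w ^ 2 := by nlinarith [sq_nonneg (|w1| - |w|)]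
  have h4 : P * (2 * (|w1| * |w|)) ≤ P * (w1 ^ 2 + w ^ 2) := by gcongr
  have h5 : 2 * (|w1| * ε) ≤ w1 ^ 2 + ε ^ 2 := by nlinarith [sq_nonneg (|w1| - ε)]
  have h6 : 0 < P * ε ^ 2 := by positivity
  nlinarith [sq_nonneg w]

/-- Quantitative continuous dependence on the exponent for the singular initial value problem. -/
lemma RadialProfile.dist_le {lam Lam c P ε R R' ρ ρ' : ℝ} {v v1 v2 u u1 u2 : ℝ → ℝ}
    (hlam : 0 < lam) (hlL : lam ≤ Lam) (hc : 0 ≤ c) (hε : 0 < ε) (hp : 1 < P - ε)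
    (hv : RadialProfile lam Lam c (P - ε) R ρ v v1 v2)
    (hu : RadialProfile lam Lam c P R' ρ' u u1 u2) {r : ℝ} (hr0 : 0 ≤ r) (hrR : r < R)
    (hrR' : r < R') :
    (v r - u r) ^ 2 + (v1 r - u1 r) ^ 2 ≤ ε ^ 2 * exp ((1 + (P + 1) / lam) * r) := by
  set C := 1 + (P + 1) / lam with hC
  have hIcc : ∀ s ∈ Icc 0 r, s ∈ Ico 0 R ∧ s ∈ Ico 0 R' := fun s hs =>
    ⟨⟨hs.1, hs.2.trans_lt hrR⟩, ⟨hs.1, hs.2.trans_lt hrR'⟩⟩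
  have hE' : ∀ s ∈ Ioo 0 r, HasDerivAt (fun s => (v s - u s) ^ 2 + (v1 s - u1 s) ^ 2)
      (2 * (v s - u s) * (v1 s - u1 s) + 2 * (v1 s - u1 s) * (v2 s - u2 s)) s := fun s hs => by
    have hs1 : s ∈ Ioo 0 R := ⟨hs.1, hs.2.trans hrR⟩
    have hs2 : s ∈ Ioo 0 R' := ⟨hs.1, hs.2.trans hrR'⟩
    refine ((((hv.hasDerivAt s hs1).sub (hu.hasDerivAt s hs2)).pow 2).add
      (((hv.hasDerivAt_deriv s hs1).sub (hu.hasDerivAt_deriv s hs2)).pow 2)).congr_deriv ?_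
    simp
  have hbound : ∀ s ∈ Ioo 0 r,
      2 * (v s - u s) * (v1 s - u1 s) + 2 * (v1 s - u1 s) * (v2 s - u2 s) ≤
        C * ((v s - u s) ^ 2 + (v1 s - u1 s) ^ 2 + ε ^ 2) := fun s hs => by
    have hs1 : s ∈ Ioo 0 R := ⟨hs.1, hs.2.trans hrR⟩
    have hs2 : s ∈ Ioo 0 R' := ⟨hs.1, hs.2.trans hrR'⟩
    obtain ⟨θ, hθ, hθe⟩ := exists_pucci_slope hlL (v2 s) (u2 s)
    have e1 := hv.eqn s hs1
    have e2 := hu.eqn s hs2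
    have hv0 := hv.pos s ⟨hs.1.le, hs1.2⟩
    have hu0 := hu.pos s ⟨hs.1.le, hs2.2⟩
    have hv1 := hv.le_one ⟨hs.1.le, hs1.2⟩
    have hu1 := hu.le_one ⟨hs.1.le, hs2.2⟩
    have f1 : |v s ^ (P - ε) - u s ^ P| ≤ P * |v s - u s| + ε := by
      calc |v s ^ (P - ε) - u s ^ P|
          ≤ |v s ^ (P - ε) - u s ^ (P - ε)| + |u s ^ (P - ε) - u s ^ P| := abs_sub_le _ _ _
        _ ≤ (P - ε) * |v s - u s| + ε := add_le_add (abs_rpow_sub_rpow_le hp hv0 hv1 hu0 hu1)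
            (abs_rpow_sub_rpow_exponent_le hε.le hp hu0 hu1)
        _ ≤ P * |v s - u s| + ε := by gcongr; linarith
    set w := v s - u s
    set w1 := v1 s - u1 s with hw1
    set Δ := v2 s - u2 s
    have g1 : θ * Δ = -(v s ^ (P - ε) - u s ^ P) - c * lam * (w1 / s) := by
      rw [hw1, sub_div]; linarith
    have g5 := two_mul_mul_le (w1 := w1) hlam (by linarith : 0 < P) hε hθ
      (show 0 ≤ c * lam / s by have := hs.1; positivity) f1 (by rw [g1]; ring)
    rw [hC]
    nlinarith [sq_nonneg (w - w1), sq_nonneg ε]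
  have hanti : AntitoneOn (fun s => ((v s - u s) ^ 2 + (v1 s - u1 s) ^ 2 + ε ^ 2) * exp (-C * s))
      (Icc 0 r) := by
    refine antitoneOn_of_hasDerivWithinAt_nonpos (convex_Icc 0 r) ?_
      (f' := fun s => ((2 * (v s - u s) * (v1 s - u1 s) + 2 * (v1 s - u1 s) * (v2 s - u2 s)) -
        C * ((v s - u s) ^ 2 + (v1 s - u1 s) ^ 2 + ε ^ 2)) * exp (-C * s))
      (fun s hs => ?_) (fun s hs => ?_)
    · have c1 := hv.cont.mono (fun s hs => Ico_subset_Icc_self (hIcc s hs).1)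
      have c2 := hu.cont.mono (fun s hs => Ico_subset_Icc_self (hIcc s hs).2)
      have c3 := hv.cont_deriv.mono (fun s hs => (hIcc s hs).1)
      have c4 := hu.cont_deriv.mono (fun s hs => (hIcc s hs).2)
      fun_prop
    · rw [interior_Icc] at hs
      have h1 : HasDerivAt (fun s => exp (-C * s)) (exp (-C * s) * (-C * 1)) s :=
        ((hasDerivAt_id s).const_mul (-C)).exp
      refine ((((hE' s hs).add_const (ε ^ 2)).mul h1).congr_deriv ?_).hasDerivWithinAt
      ring
    · rw [interior_Icc] at hs
      exact mul_nonpos_of_nonpos_of_nonneg (by linarith [hbound s hs]) (exp_pos _).le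
  have h1 := hanti ⟨le_rfl, hr0⟩ ⟨hr0, le_rfl⟩ hr0
  simp only [hv.zero, hu.zero, hv.deriv_zero, hu.deriv_zero, sub_self, mul_zero, exp_zero,
    mul_one] at h1
  have h2 : exp (-C * r) * exp (C * r) = 1 := by rw [← exp_add]; simp
  have h3 := mul_le_mul_of_nonneg_right h1 (exp_pos (C * r)).le
  rw [mul_assoc, h2] at h3
  norm_num at h3
  nlinarith [sq_nonneg ε]

lemma ContDiffOn.hasDerivAt_deriv_deriv {u : ℝ → ℝ} {s t : Set ℝ} (h : ContDiffOn ℝ 2 u s)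
    (ht : IsOpen t) (hts : t ⊆ s) {r : ℝ} (hr : r ∈ t) :
    HasDerivAt u (deriv u r) r ∧ HasDerivAt (deriv u) (deriv (deriv u) r) r := by
  have h1 : ContDiffOn ℝ (1 + 1) u t := by
    have := h.mono hts
    norm_num
    exact this
  have h2 := (contDiffOn_succ_iff_deriv_of_isOpen ht).1 h1
  exact ⟨(h2.1.differentiableAt (ht.mem_nhds hr)).hasDerivAt,
    ((h2.2.2.differentiableOn one_ne_zero).differentiableAt (ht.mem_nhds hr)).hasDerivAt⟩

lemma radialPucci_of_deriv_neg {lam Lam : ℝ} {N : ℕ} {u : ℝ → ℝ} {r : ℝ} (hr : 0 < r)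
    (hu : deriv u r < 0) : radialPucci lam Lam N u r = Lam * max (deriv (deriv u) r) 0 +
      lam * min (deriv (deriv u) r) 0 + ((N : ℝ) - 1) * lam * (deriv u r / r) := by
  have h : deriv u r / r < 0 := div_neg_of_neg_of_pos hu hr
  rw [radialPucci, max_eq_right h.le, min_eq_left h.le]
  ring

lemma IsEntireSol.radialProfile {lam Lam Ntil p c1 R0 R : ℝ} {N : ℕ} {U : ℝ → ℝ}
    (h : IsEntireSol lam Lam N Ntil p c1 R0 U) (hR : R0 < R) :
    RadialProfile lam Lam ((N : ℝ) - 1) p R R0 U (deriv U) (deriv (deriv U)) := by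
  obtain ⟨hC, hpos, h0, h0', hneg, heq, hR0, hconc, hR0', hconv, -, -, -⟩ := h
  have hd : ∀ r, 0 < r →
      HasDerivAt U (deriv U r) r ∧ HasDerivAt (deriv U) (deriv (deriv U) r) r := fun r hr =>
    hC.hasDerivAt_deriv_deriv isOpen_Ioi Ioi_subset_Ici_self hr
  refine ⟨hR0, hR, hC.continuousOn.mono fun x hx => hx.1, fun r hr => ?_,
    fun r hr => (hd r hr.1).1, fun r hr => (hd r hr.1).2, h0, h0', fun r hr => hpos r hr.1,
    fun r hr => hneg r hr.1, fun r hr => ?_, fun r hr => hconc r ⟨hr.1.le, hr.2⟩,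
    fun r hr => hconv r hr.1⟩
  · rcases hr.1.lt_or_eq with h | h
    · exact (hd r h).2.continuousAt.continuousWithinAt
    · rw [← h]
      exact (differentiableAt_of_deriv_ne_zero
        (hconc 0 ⟨le_rfl, hR0⟩).ne).continuousAt.continuousWithinAt
  · rw [← radialPucci_of_deriv_neg hr.1 (hneg r hr.1), ← heq r hr.1, neg_neg]

lemma IsDirichletSol.deriv_neg {lam Lam q r0 : ℝ} {N : ℕ} {u : ℝ → ℝ}
    (h : IsDirichletSol lam Lam N q u) (hr0 : InflectionAt u r0) :
    ContinuousOn (deriv u) (Ico 0 1) ∧ ∀ r ∈ Ioo (0 : ℝ) 1, deriv u r < 0 := by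
  obtain ⟨hC, hpos, h1, h0, hneg, heq⟩ := h
  obtain ⟨⟨hr0, hr01⟩, hconc, hr0', hconv⟩ := hr0
  have hcont : ContinuousOn (deriv u) (Ico 0 1) := fun r hr => by
    rcases hr.1.lt_or_eq with h | h
    · exact (hC.hasDerivAt_deriv_deriv isOpen_Ioo Ioo_subset_Icc_self
        ⟨h, hr.2⟩).2.continuousAt.continuousWithinAt
    · rw [← h]
      exact (differentiableAt_of_deriv_ne_zero
        (hconc 0 ⟨le_rfl, hr0⟩).ne).continuousAt.continuousWithinAt
  refine ⟨hcont, fun r hr => ?_⟩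
  rcases le_or_gt r r0 with h | h
  · have hanti : StrictAntiOn (deriv u) (Icc 0 r0) :=
      strictAntiOn_of_deriv_neg (convex_Icc 0 r0)
        (hcont.mono fun x hx => ⟨hx.1, hx.2.trans_lt hr01⟩) fun x hx => by
          rw [interior_Icc] at hx
          exact hconc x ⟨hx.1.le, hx.2⟩
    have := hanti ⟨le_rfl, hr0.le⟩ ⟨hr.1.le, h⟩ hr.1
    rwa [h0] at this
  · have hmono : StrictMonoOn (deriv u) (Ico r0 1) :=
      strictMonoOn_of_deriv_pos (convex_Ico r0 1)
        (hcont.mono fun x hx => ⟨hr0.le.trans hx.1, hx.2⟩) fun x hx => by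
          rw [interior_Ico] at hx
          exact hconv x hx
    have h2 : r < (r + 1) / 2 := by linarith [hr.2]
    have h3 : (r + 1) / 2 < 1 := by linarith [hr.2]
    exact (hmono ⟨h.le, hr.2⟩ ⟨(h.trans h2).le, h3⟩ h2).trans_le
      (hneg _ ⟨(hr.1.trans h2).le, h3.le⟩)

/-- Blow-up rescaling of a Dirichlet solution. -/
lemma IsDirichletSol.radialProfile {lam Lam q r0 M k : ℝ} {N : ℕ} {u : ℝ → ℝ}
    (h : IsDirichletSol lam Lam N q u) (hr0 : InflectionAt u r0) (hM : M = u 0)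
    (hk : k = M ^ ((q - 1) / 2)) :
    RadialProfile lam Lam ((N : ℝ) - 1) q k (k * r0) (fun s => u (s / k) / M)
      (fun s => deriv u (s / k) / (M * k)) (fun s => deriv (deriv u) (s / k) / (M * k ^ 2)) := by
  obtain ⟨hcont, hneg⟩ := h.deriv_neg hr0
  obtain ⟨hC, hpos, h1, h0, -, heq⟩ := h
  obtain ⟨⟨hr0, hr01⟩, hconc, hr0', hconv⟩ := hr0
  have hM0 : 0 < M := hM ▸ hpos 0 ⟨le_rfl, one_pos⟩
  have hk0 : 0 < k := hk ▸ rpow_pos_of_pos hM0 _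
  have hk2 : M * k ^ 2 = M ^ q := by
    rw [hk, ← rpow_natCast, ← rpow_mul hM0.le]
    nth_rewrite 1 [← rpow_one M]
    rw [← rpow_add hM0]
    congr 1
    push_cast
    ring
  have hd : ∀ r ∈ Ioo (0 : ℝ) 1,
      HasDerivAt u (deriv u r) r ∧ HasDerivAt (deriv u) (deriv (deriv u) r) r := fun r hr =>
    hC.hasDerivAt_deriv_deriv isOpen_Ioo Ioo_subset_Icc_self hr
  have hIoo : ∀ s ∈ Ioo 0 k, s / k ∈ Ioo (0 : ℝ) 1 := fun s hs =>
    ⟨div_pos hs.1 hk0, (div_lt_one hk0).2 hs.2⟩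
  have hIco : ∀ s ∈ Ico 0 k, s / k ∈ Ico (0 : ℝ) 1 := fun s hs =>
    ⟨div_nonneg hs.1 hk0.le, (div_lt_one hk0).2 hs.2⟩
  have hdiv : ∀ s : ℝ, HasDerivAt (fun s => s / k) (1 / k) s := fun s =>
    (hasDerivAt_id s).div_const k
  refine ⟨by positivity, by nlinarith, ?_, ?_, fun s hs => ?_, fun s hs => ?_, ?_, ?_,
    fun s hs => div_pos (hpos _ (hIco s hs)) hM0,
    fun s hs => div_neg_of_neg_of_pos (hneg _ (hIoo s hs)) (by positivity), fun s hs => ?_,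
    fun s hs => div_neg_of_neg_of_pos
      (hconc _ ⟨div_nonneg hs.1.le hk0.le, (div_lt_iff₀' hk0).2 hs.2⟩) (by positivity),
    fun s hs => div_pos (hconv _ ⟨(lt_div_iff₀' hk0).2 hs.1, (div_lt_one hk0).2 hs.2⟩)
      (by positivity)⟩
  · exact (hC.continuousOn.comp (by fun_prop) fun s hs =>
      ⟨div_nonneg hs.1 hk0.le, (div_le_one hk0).2 hs.2⟩).div_const M
  · exact (hcont.comp (by fun_prop) hIco).div_const (M * k)
  · refine (((hd _ (hIoo s hs)).1.comp s (hdiv s)).div_const M).congr_deriv ?_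
    field_simp
  · refine (((hd _ (hIoo s hs)).2.comp s (hdiv s)).div_const (M * k)).congr_deriv ?_
    field_simp
  · simp [← hM, hM0.ne']
  · simp [h0]
  · have h2 := heq _ (hIoo s hs)
    rw [radialPucci_of_deriv_neg (hIoo s hs).1 (hneg _ (hIoo s hs))] at h2
    rw [div_rpow (hpos _ (hIco s (Ioo_subset_Ico_self hs))).le hM0.le, ← hk2, ← h2]
    have hmax : max (deriv (deriv u) (s / k) / (M * k ^ 2)) 0 =
        max (deriv (deriv u) (s / k)) 0 / (M * k ^ 2) := by
      rw [← max_div_div_right (by positivity), zero_div]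
    have hmin : min (deriv (deriv u) (s / k) / (M * k ^ 2)) 0 =
        min (deriv (deriv u) (s / k)) 0 / (M * k ^ 2) := by
      rw [← min_div_div_right (by positivity), zero_div]
    rw [hmax, hmin]
    have := hs.1.ne'
    field_simp

section Convergence

variable {lam Lam c P R0 : ℝ} {U U1 U2 : ℝ → ℝ} {ε R ρ : ℕ → ℝ} {v v1 v2 : ℕ → ℝ → ℝ}

lemma RadialProfile.abs_sub_le {ε R R' ρ ρ' : ℝ} {v v1 v2 u u1 u2 : ℝ → ℝ}
    (hlam : 0 < lam) (hlL : lam ≤ Lam) (hc : 0 ≤ c) (hε : 0 < ε) (hp : 1 < P - ε)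
    (hv : RadialProfile lam Lam c (P - ε) R ρ v v1 v2)
    (hu : RadialProfile lam Lam c P R' ρ' u u1 u2) {r : ℝ} (hr0 : 0 ≤ r) (hrR : r < R)
    (hrR' : r < R') :
    |v r - u r| ≤ ε * exp ((1 + (P + 1) / lam) * r) ∧
      |v1 r - u1 r| ≤ ε * exp ((1 + (P + 1) / lam) * r) := by
  have h1 := hv.dist_le hlam hlL hc hε hp hu hr0 hrR hrR'
  have h2 : 1 ≤ exp ((1 + (P + 1) / lam) * r) := by
    rw [one_le_exp_iff]
    have : 0 < P := by linarith
    positivity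
  have h3 : ε ^ 2 * exp ((1 + (P + 1) / lam) * r) ≤
      (ε * exp ((1 + (P + 1) / lam) * r)) ^ 2 := by
    rw [mul_pow]
    gcongr
    nlinarith
  constructor <;> refine abs_le_of_sq_le_sq ?_ (by positivity)
  · nlinarith [sq_nonneg (v1 r - u1 r)]
  · nlinarith [sq_nonneg (v r - u r)]

lemma eventually_lt_radius (hlam : 0 < lam) (hlL : lam ≤ Lam) (hc : 0 ≤ c)
    (hU : ∀ R, R0 < R → RadialProfile lam Lam c P R R0 U U1 U2)
    (hε : ∀ n, 0 < ε n) (hε0 : Tendsto ε atTop (nhds 0)) (hp : ∀ n, 1 < P - ε n)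
    (hv : ∀ n, RadialProfile lam Lam c (P - ε n) (R n) (ρ n) (v n) (v1 n) (v2 n))
    (hvR : ∀ n, v n (R n) = 0) (S : ℝ) : ∀ᶠ n in atTop, S < R n := by
  wlog hS : R0 < S generalizing S
  · filter_upwards [this (R0 + 1) (by linarith)] with n hn
    linarith
  have hUS1 := hU (S + 1) (by linarith)
  have hS0 : 0 < S := hUS1.rho_pos.trans hS
  have hUS := hUS1.pos S ⟨hS0.le, by linarith⟩
  have hlim : Tendsto (fun n => ε n * exp ((1 + (P + 1) / lam) * S)) atTop (nhds 0) := by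
    simpa using hε0.mul_const (exp ((1 + (P + 1) / lam) * S))
  filter_upwards [hlim.eventually_lt_const (half_pos hUS)] with n hn
  by_contra! hRS
  have hR0 : 0 < R n := (hv n).rho_pos.trans (hv n).rho_lt
  have hU1 : U S ≤ 1 := hUS1.le_one ⟨hS0.le, by linarith⟩
  obtain ⟨r, hr, hvr⟩ := intermediate_value_Icc' hR0.le (hv n).cont
    (show U S / 2 ∈ Icc (v n (R n)) (v n 0) by
      rw [hvR, (hv n).zero]; constructor <;> linarith)
  have hrR : r < R n := by
    rcases hr.2.lt_or_eq with h | h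
    · exact h
    · rw [h, hvR] at hvr
      linarith
  have h1 := ((hv n).abs_sub_le hlam hlL hc (hε n) (hp n) hUS1 hr.1 hrR (by linarith)).1
  have h2 : U S ≤ U r := hUS1.antitoneOn ⟨hr.1, by linarith⟩ ⟨hS0.le, by linarith⟩ (by linarith)
  have h3 : ε n * exp ((1 + (P + 1) / lam) * r) ≤ ε n * exp ((1 + (P + 1) / lam) * S) := by
    have := hε n
    have := hp n
    have : 0 ≤ P + 1 := by linarith
    gcongr
    linarith
  rw [hvr, abs_le] at h1
  linarith

lemma tendsto_profile (hlam : 0 < lam) (hlL : lam ≤ Lam) (hc : 0 ≤ c)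
    (hU : ∀ R, R0 < R → RadialProfile lam Lam c P R R0 U U1 U2)
    (hε : ∀ n, 0 < ε n) (hε0 : Tendsto ε atTop (nhds 0)) (hp : ∀ n, 1 < P - ε n)
    (hv : ∀ n, RadialProfile lam Lam c (P - ε n) (R n) (ρ n) (v n) (v1 n) (v2 n))
    (hvR : ∀ n, v n (R n) = 0) {r : ℝ} (hr : 0 ≤ r) :
    Tendsto (fun n => v n r) atTop (nhds (U r)) ∧
      Tendsto (fun n => v1 n r) atTop (nhds (U1 r)) := by
  have hlim : Tendsto (fun n => ε n * exp ((1 + (P + 1) / lam) * r)) atTop (nhds 0) := by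
    simpa using hε0.mul_const (exp ((1 + (P + 1) / lam) * r))
  have hbd : ∀ᶠ n in atTop, |v n r - U r| ≤ ε n * exp ((1 + (P + 1) / lam) * r) ∧
      |v1 n r - U1 r| ≤ ε n * exp ((1 + (P + 1) / lam) * r) := by
    filter_upwards [eventually_lt_radius hlam hlL hc hU hε hε0 hp hv hvR r] with n hn
    exact (hv n).abs_sub_le hlam hlL hc (hε n) (hp n) (hU (max r R0 + 1) (by
      linarith [le_max_right r R0])) hr hn (by linarith [le_max_left r R0])
  exact ⟨tendsto_sub_nhds_zero_iff.1 (squeeze_zero_norm' (hbd.mono fun n h => h.1) hlim),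
    tendsto_sub_nhds_zero_iff.1 (squeeze_zero_norm' (hbd.mono fun n h => h.2) hlim)⟩

lemma tendsto_inflection (hlam : 0 < lam) (hlL : lam ≤ Lam) (hc : 0 ≤ c)
    (hU : ∀ R, R0 < R → RadialProfile lam Lam c P R R0 U U1 U2)
    (hε : ∀ n, 0 < ε n) (hε0 : Tendsto ε atTop (nhds 0)) (hp : ∀ n, 1 < P - ε n)
    (hv : ∀ n, RadialProfile lam Lam c (P - ε n) (R n) (ρ n) (v n) (v1 n) (v2 n))
    (hvR : ∀ n, v n (R n) = 0) : Tendsto ρ atTop (nhds R0) := by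
  have hR0 : 0 < R0 := (hU (R0 + 1) (by linarith)).rho_pos
  have hLam : 0 < Lam := hlam.trans_le hlL
  have hG : ∀ r, 0 < r → Tendsto (fun n => Lam * max (v2 n r) 0 + lam * min (v2 n r) 0) atTop
      (nhds (Lam * max (U2 r) 0 + lam * min (U2 r) 0)) := fun r hr => by
    obtain ⟨h1, h2⟩ := tendsto_profile hlam hlL hc hU hε hε0 hp hv hvR hr.le
    have hUr := hU (max r R0 + 1) (by linarith [le_max_right r R0])
    have hrm : r < max r R0 + 1 := by linarith [le_max_left r R0]
    have hpP : Tendsto (fun n => P - ε n) atTop (nhds P) := by simpa using hε0.const_sub P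
    have h3 := ((h1.rpow hpP (Or.inl (hUr.pos r ⟨hr.le, hrm⟩).ne')).neg).sub
      ((h2.div_const r).const_mul (c * lam))
    have h4 : -U r ^ P - c * lam * (U1 r / r) = Lam * max (U2 r) 0 + lam * min (U2 r) 0 := by
      linarith [hUr.eqn r ⟨hr, hrm⟩]
    rw [h4] at h3
    refine h3.congr' ?_
    filter_upwards [eventually_lt_radius hlam hlL hc hU hε hε0 hp hv hvR r] with n hn
    linarith [(hv n).eqn r ⟨hr, hn⟩]
  refine tendsto_order.2 ⟨fun a ha => ?_, fun a ha => ?_⟩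
  · obtain ⟨r, hr, hrR⟩ := exists_between (max_lt ha hR0)
    have hr0 : 0 < r := (le_max_right _ _).trans_lt hr
    have hneg := (hU (R0 + 1) (by linarith)).concave r ⟨hr0, hrR⟩
    have hGr := hG r hr0
    rw [max_eq_right hneg.le, min_eq_left hneg.le] at hGr
    filter_upwards [hGr.eventually_lt_const (u := 0) (by nlinarith),
      eventually_lt_radius hlam hlL hc hU hε hε0 hp hv hvR r] with n hn hrn
    by_contra! h
    have h1 := (hv n).convex r ⟨h.trans_lt ((le_max_left _ _).trans_lt hr), hrn⟩
    rw [max_eq_left h1.le, min_eq_right h1.le] at hn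
    nlinarith
  · obtain ⟨r, hr, hra⟩ := exists_between ha
    have hr0 : 0 < r := hR0.trans hr
    have hpos := (hU (r + 1) (by linarith)).convex r ⟨hr, by linarith⟩
    have hGr := hG r hr0
    rw [max_eq_left hpos.le, min_eq_right hpos.le] at hGr
    filter_upwards [hGr.eventually_const_lt (u := 0) (by nlinarith [mul_pos hLam hpos])] with n hn
    by_contra! h
    have h1 := (hv n).concave r ⟨hr0, hra.trans_le h⟩
    rw [max_eq_right h1.le, min_eq_left h1.le] at hn
    nlinarith

end Convergence

section FastDecay

variable {lam Lam c P R0 D c1 : ℝ} {U U1 U2 : ℝ → ℝ}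

/-- Fast decay forces the exponent above `Ñ / (Ñ - 2)`. -/
lemma two_lt_of_fast_decay (hLam : 0 < Lam) (hD : lam / Lam * c = D + 1)
    (hP : 1 < P) (hU : ∀ R, R0 < R → RadialProfile lam Lam c P R R0 U U1 U2) (hc1 : 0 < c1)
    (hdec : Tendsto (fun r : ℝ => r ^ D * U r) atTop (nhds c1))
    (hdec1 : Tendsto (fun r : ℝ => r ^ (D + 1) * U1 r) atTop (nhds (-D * c1))) :
    2 < (P - 1) * D := by
  by_contra! hPD
  obtain ⟨κ, hκ⟩ : ∃ κ, κ = (c1 / 2) ^ P / Lam := ⟨_, rfl⟩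
  have hκ0 : 0 < κ := by rw [hκ]; positivity
  obtain ⟨S, hS⟩ := eventually_atTop.1 ((hdec.eventually_const_lt (half_lt_self hc1)).and
    ((eventually_gt_atTop R0).and (eventually_ge_atTop 1)))
  have hlog : ∀ r, S ≤ r → r ^ (D + 1) * U1 r + κ * log r ≤ S ^ (D + 1) * U1 S + κ * log S := by
    intro r hr
    have hanti : AntitoneOn (fun r => r ^ (D + 1) * U1 r + κ * log r) (Ico S (r + 1)) := by
      refine antitoneOn_Ico_of_hasDerivAt
        (f' := fun s => ((D + 1) * s ^ (D + 1 - 1) * U1 s + s ^ (D + 1) * U2 s) + κ * s⁻¹)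
        (fun s hs => ?_) (fun s hs => ?_)
      all_goals
        obtain ⟨hs1, hs2, hs3⟩ := hS s hs.1
        have hs0 : 0 < s := one_pos.trans_le hs3
        have hp := hU (s + 1) (by linarith)
      · exact ((hasDerivAt_rpow_const (Or.inl hs0.ne')).mul
          (hp.hasDerivAt_deriv s ⟨hs0, by linarith⟩)).add ((hasDerivAt_log hs0.ne').const_mul κ)
      · rw [hp.convex_eqn hLam hD s ⟨hs2, by linarith⟩, rpow_sub_one hs0.ne']
        have h1 : (D + 1) * (s ^ (D + 1) / s) * U1 s +
            s ^ (D + 1) * (-(D + 1) * U1 s / s - U s ^ P / Lam) + κ * s⁻¹ =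
            κ * s⁻¹ - s ^ (D + 1) * U s ^ P / Lam := by
          field_simp
          ring
        rw [h1]
        have h2 : (c1 / 2) ^ P ≤ (s ^ D * U s) ^ P := by gcongr
        have h3 : (s ^ D * U s) ^ P = s ^ (D * P) * U s ^ P := by
          rw [mul_rpow (by positivity) (hp.pos s ⟨hs0.le, by linarith⟩).le, rpow_mul hs0.le]
        have h4 : s ^ (D * P) ≤ s * s ^ (D + 1) := by
          calc s ^ (D * P) ≤ s ^ (1 + (D + 1)) := rpow_le_rpow_of_exponent_le hs3 (by nlinarith)
            _ = s * s ^ (D + 1) := by rw [rpow_add hs0, rpow_one]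
        have h5 : 0 < U s ^ P := rpow_pos_of_pos (hp.pos s ⟨hs0.le, by linarith⟩) _
        have h6 : (c1 / 2) ^ P ≤ s * s ^ (D + 1) * U s ^ P :=
          h2.trans (h3.le.trans (mul_le_mul_of_nonneg_right h4 h5.le))
        have h7 : κ * s⁻¹ ≤ s ^ (D + 1) * U s ^ P / Lam := by
          rw [hκ, div_mul_eq_mul_div]
          refine div_le_div_of_nonneg_right ?_ hLam.le
          rw [mul_inv_le_iff₀ hs0]
          linarith
        linarith
    exact hanti ⟨le_rfl, by linarith⟩ ⟨hr, by linarith⟩ hr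
  have hbot : Tendsto (fun r : ℝ => r ^ (D + 1) * U1 r + κ * log r) atTop atTop :=
    hdec1.add_atTop (tendsto_log_atTop.const_mul_atTop hκ0)
  obtain ⟨r, hr, hrS⟩ := ((hbot.eventually_gt_atTop (S ^ (D + 1) * U1 S + κ * log S)).and
    (eventually_ge_atTop S)).exists
  exact absurd (hlog r hrS) (not_le.2 hr)

lemma tendsto_phase_of_fast_decay (hLam : 0 < Lam)
    (hPD : 2 < (P - 1) * D) (hU : ∀ R, R0 < R → RadialProfile lam Lam c P R R0 U U1 U2)
    (hc1 : 0 < c1) (hdec : Tendsto (fun r : ℝ => r ^ D * U r) atTop (nhds c1))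
    (hdec1 : Tendsto (fun r : ℝ => r ^ (D + 1) * U1 r) atTop (nhds (-D * c1))) :
    Tendsto (fun r => -r * U1 r / U r) atTop (nhds D) ∧
      Tendsto (fun r => (-r * U1 r / U r) * (-r * U r ^ P / (Lam * U1 r))) atTop (nhds 0) := by
  constructor
  · have h1 := hdec1.neg.div hdec hc1.ne'
    have h2 : -(-D * c1) / c1 = D := by field_simp
    rw [h2] at h1
    refine h1.congr' ?_
    filter_upwards [eventually_gt_atTop R0] with r hr
    have hp := hU (r + 1) (by linarith)
    have hr0 : 0 < r := hp.rho_pos.trans hr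
    have h3 := (hp.pos r ⟨hr0.le, by linarith⟩).ne'
    have h4 : r ^ D ≠ 0 := (rpow_pos_of_pos hr0 D).ne'
    simp only [Pi.div_apply]
    rw [rpow_add_one hr0.ne']
    field_simp
  · have h1 : Tendsto (fun r : ℝ => r ^ (-((P - 1) * D - 2))) atTop (nhds 0) :=
      tendsto_rpow_neg_atTop (by linarith)
    have h2 := (h1.mul (hdec.rpow_const (p := P - 1) (Or.inl hc1.ne'))).div_const Lam
    rw [zero_mul, zero_div] at h2
    refine h2.congr' ?_
    filter_upwards [eventually_gt_atTop R0] with r hr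
    have hp := hU (r + 1) (by linarith)
    have hr0 : 0 < r := hp.rho_pos.trans hr
    have h3 := hp.pos r ⟨hr0.le, by linarith⟩
    have h4 := (hp.deriv_neg r ⟨hr0, by linarith⟩).ne
    rw [mul_rpow (by positivity) h3.le, ← rpow_mul hr0.le, ← mul_assoc, ← rpow_add hr0,
      rpow_sub_one h3.ne']
    have h5 : -((P - 1) * D - 2) + D * (P - 1) = (2 : ℕ) := by push_cast; ring
    rw [h5, rpow_natCast]
    field_simp

end FastDecay

lemma exists_uniform_decay {lam Lam c P R0 D c1 b b2 : ℝ} {U U1 U2 : ℝ → ℝ} {ε R ρ : ℕ → ℝ}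
    {v v1 v2 : ℕ → ℝ → ℝ} (hlam : 0 < lam) (hlL : lam ≤ Lam) (hc : 0 ≤ c)
    (hD : lam / Lam * c = D + 1)
    (hU : ∀ R, R0 < R → RadialProfile lam Lam c P R R0 U U1 U2)
    (hε : ∀ n, 0 < ε n) (hε0 : Tendsto ε atTop (nhds 0)) (hp : ∀ n, 1 < P - ε n)
    (hv : ∀ n, RadialProfile lam Lam c (P - ε n) (R n) (ρ n) (v n) (v1 n) (v2 n))
    (hvR : ∀ n, v n (R n) = 0) (hc1 : 0 < c1)
    (hdec : Tendsto (fun r : ℝ => r ^ D * U r) atTop (nhds c1))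
    (hdec1 : Tendsto (fun r : ℝ => r ^ (D + 1) * U1 r) atTop (nhds (-D * c1)))
    (hb : 0 < b) (hPb : 2 < (P - 1) * b) (hbb : b < b2) (hb2 : b2 < D) :
    ∃ S, 1 ≤ S ∧ R0 < S ∧ ∀ᶠ n in atTop, ∀ r ∈ Ico S (R n), v n r ≤ S ^ b * r ^ (-b) := by
  have hLam : 0 < Lam := hlam.trans_le hlL
  have hP : 1 < P := by linarith [hε 0, hp 0]
  obtain ⟨δ, hδ, H⟩ := exists_tail_bound hLam hD hb hbb hb2 hP
  obtain ⟨hX, hZ⟩ := tendsto_phase_of_fast_decay hLam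
    (by nlinarith) hU hc1 hdec hdec1
  obtain ⟨S, hSX, hSZ, hSR, hS1⟩ := ((hX.eventually_const_lt (hbb.trans hb2)).and
    ((hZ.eventually_lt_const hδ).and ((eventually_gt_atTop R0).and (eventually_ge_atTop 1)))).exists
  have hS0 : 0 < S := one_pos.trans_le hS1
  refine ⟨S, hS1, hSR, ?_⟩
  have hUS := hU (S + 1) (by linarith)
  have hUpos := hUS.pos S ⟨hS0.le, by linarith⟩
  have hU1neg := hUS.deriv_neg S ⟨hS0, by linarith⟩
  obtain ⟨hvS, hv1S⟩ := tendsto_profile hlam hlL hc hU hε hε0 hp hv hvR hS0.le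
  have hpP : Tendsto (fun n => P - ε n) atTop (nhds P) := by simpa using hε0.const_sub P
  have hXn := (hv1S.const_mul (-S)).div hvS hUpos.ne'
  have hZn := hXn.mul (((hvS.rpow hpP (Or.inl hUpos.ne')).const_mul (-S)).div
    (hv1S.const_mul Lam) (mul_neg_of_pos_of_neg hLam hU1neg).ne)
  filter_upwards [hXn.eventually_const_lt hSX, hZn.eventually_lt_const hSZ,
    eventually_lt_radius hlam hlL hc hU hε hε0 hp hv hvR S,
    (tendsto_inflection hlam hlL hc hU hε hε0 hp hv hvR).eventually_lt_const hSR,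
    ((hpP.sub_const 1).mul_const b).eventually_const_lt hPb] with n h1 h2 h3 h4 h5 r hr
  have h6 := H _ _ _ S _ _ _ (hv n) (hvR n) (hp n) (by linarith [hε n]) h5.le h4 h3 h1 h2.le r hr
  have hr0 : 0 < r := hS0.trans_le hr.1
  have h7 := (hv n).le_one ⟨hS0.le, h3⟩
  rw [rpow_neg hr0.le, ← div_eq_mul_inv, le_div_iff₀ (rpow_pos_of_pos hr0 b)]
  exact h6.trans (mul_le_of_le_one_left (rpow_nonneg hS0.le b) h7)

open MeasureTheory in
lemma integral_ball_rescale {N : ℕ} {p γ k M ρ : ℝ} {u : ℝ → ℝ} (hp : 1 < p) (hM : 0 < M)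
    (hk : k = M ^ ((p - 1) / 2)) (hρ : 0 < ρ) (hu : ∀ r ∈ Ico (0 : ℝ) 1, 0 < u r)
    (hγ : γ = 2 * (p + 1) / (p - 1) - N) :
    ∫ x in Metric.ball (0 : EuclideanSpace ℝ (Fin N)) 1, u ‖x‖ ^ (p + 1) * max ρ ‖x‖ ^ γ =
      ∫ y, (Metric.ball (0 : EuclideanSpace ℝ (Fin N)) k).indicator
        (fun y => (u (‖y‖ / k) / M) ^ (p + 1) * max (k * ρ) ‖y‖ ^ γ) y := by
  have hk0 : 0 < k := hk ▸ rpow_pos_of_pos hM _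
  have hkM : k ^ γ * k ^ N = M ^ (p + 1) := by
    rw [← rpow_natCast, ← rpow_add hk0, hk, ← rpow_mul hM.le, hγ]
    congr 1
    have : p - 1 ≠ 0 := by linarith
    field_simp
    ring
  have h1 := Measure.integral_comp_smul volume
    ((Metric.ball (0 : EuclideanSpace ℝ (Fin N)) k).indicator
      (fun y => (u (‖y‖ / k) / M) ^ (p + 1) * max (k * ρ) ‖y‖ ^ γ)) k
  rw [finrank_euclideanSpace_fin, abs_of_pos (by positivity), smul_eq_mul, inv_mul_eq_div,
    eq_div_iff (by positivity)] at h1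
  rw [← h1, ← integral_indicator Metric.isOpen_ball.measurableSet, ← integral_mul_const]
  congr 1
  ext x
  have hmem : k • x ∈ Metric.ball (0 : EuclideanSpace ℝ (Fin N)) k ↔
      x ∈ Metric.ball (0 : EuclideanSpace ℝ (Fin N)) 1 := by
    simp only [mem_ball_zero_iff, norm_smul, norm_of_nonneg hk0.le]
    exact mul_lt_iff_lt_one_right hk0
  by_cases hx : x ∈ Metric.ball (0 : EuclideanSpace ℝ (Fin N)) 1
  · rw [indicator_of_mem hx, indicator_of_mem (hmem.2 hx), norm_smul, norm_of_nonneg hk0.le,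
      mul_div_cancel_left₀ _ hk0.ne', ← mul_max_of_nonneg _ _ hk0.le,
      mul_rpow hk0.le (le_max_of_le_left hρ.le),
      div_rpow (hu _ ⟨norm_nonneg x, mem_ball_zero_iff.1 hx⟩).le hM.le, ← hkM]
    field_simp
  · rw [indicator_of_notMem hx, indicator_of_notMem (mt hmem.1 hx), zero_mul]

lemma ite_rpow_eq_max_rpow (a x γ : ℝ) : (if x ≤ a then a ^ γ else x ^ γ) = max a x ^ γ := by
  split_ifs with h
  · rw [max_eq_left h]
  · rw [max_eq_right (not_le.1 h).le]

lemma rpow_le_exp_of_mem_Icc {a b y γ Γ : ℝ} (ha : 0 < a) (hy : y ∈ Icc a b) (hγ : |γ| ≤ Γ) :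
    y ^ γ ≤ exp ((|log a| + |log b|) * Γ) := by
  have hy0 : 0 < y := ha.trans_le hy.1
  rw [rpow_def_of_pos hy0]
  refine exp_le_exp.2 ?_
  have h1 : |log y| ≤ |log a| + |log b| := by
    have h2 := log_le_log ha hy.1
    have h3 := log_le_log hy0 hy.2
    rw [abs_le]
    constructor
    · linarith [neg_abs_le (log a), abs_nonneg (log b)]
    · linarith [le_abs_self (log b), abs_nonneg (log a)]
  calc log y * γ ≤ |log y * γ| := le_abs_self _
    _ = |log y| * |γ| := abs_mul _ _
    _ ≤ _ := by gcongr

open MeasureTheory in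
/-- Convergence of the weighted energies of the rescaled profiles. -/
lemma tendsto_energy {lam Lam P R0 D c1 γs : ℝ} {N : ℕ} {U U1 U2 : ℝ → ℝ}
    {ε R ρ γ : ℕ → ℝ} {v v1 v2 : ℕ → ℝ → ℝ} (hlam : 0 < lam) (hlL : lam ≤ Lam) (hN : 2 ≤ N)
    (hD : lam / Lam * ((N : ℝ) - 1) = D + 1)
    (hU : ∀ R, R0 < R → RadialProfile lam Lam ((N : ℝ) - 1) P R R0 U U1 U2)
    (hε : ∀ n, 0 < ε n) (hε0 : Tendsto ε atTop (nhds 0)) (hp : ∀ n, 1 < P - ε n)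
    (hv : ∀ n, RadialProfile lam Lam ((N : ℝ) - 1) (P - ε n) (R n) (ρ n) (v n) (v1 n) (v2 n))
    (hvR : ∀ n, v n (R n) = 0) (hc1 : 0 < c1)
    (hdec : Tendsto (fun r : ℝ => r ^ D * U r) atTop (nhds c1))
    (hdec1 : Tendsto (fun r : ℝ => r ^ (D + 1) * U1 r) atTop (nhds (-D * c1)))
    (hγ : ∀ n, γ n = 2 * (P - ε n + 1) / (P - ε n - 1) - N)
    (hγs : γs = 2 * (P + 1) / (P - 1) - N) :
    Integrable (fun x : EuclideanSpace ℝ (Fin N) => U ‖x‖ ^ (P + 1) * max R0 ‖x‖ ^ γs) ∧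
      Tendsto (fun n => ∫ x, (Metric.ball (0 : EuclideanSpace ℝ (Fin N)) (R n)).indicator
          (fun x => v n ‖x‖ ^ (P - ε n + 1) * max (ρ n) ‖x‖ ^ γ n) x) atTop
        (nhds (∫ x : EuclideanSpace ℝ (Fin N), U ‖x‖ ^ (P + 1) * max R0 ‖x‖ ^ γs)) := by
  have hc : (0 : ℝ) ≤ (N : ℝ) - 1 := by
    have : (2 : ℝ) ≤ N := by exact_mod_cast hN
    linarith
  have hR0 : 0 < R0 := (hU (R0 + 1) (by linarith)).rho_pos
  have hP : 1 < P := by linarith [hε 0, hp 0]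
  have hP0 : P - 1 ≠ 0 := by linarith
  have hPD := two_lt_of_fast_decay (hlam.trans_le hlL) hD hP hU hc1 hdec hdec1
  obtain ⟨b, hb, hbD⟩ := exists_between ((div_lt_iff₀' (by linarith : 0 < P - 1)).2 hPD)
  obtain ⟨b2, hbb, hb2⟩ := exists_between hbD
  have hb0 : 0 < b := (div_pos two_pos (by linarith)).trans hb
  have hPb : 2 < (P - 1) * b := (div_lt_iff₀' (by linarith)).1 hb
  obtain ⟨S, hS1, hSR, hdecay⟩ := exists_uniform_decay hlam hlL hc hD hU hε hε0 hp hv hvR hc1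
    hdec hdec1 hb0 hPb hbb hb2
  have hS0 : 0 < S := one_pos.trans_le hS1
  have hpP : Tendsto (fun n => P - ε n) atTop (nhds P) := by simpa using hε0.const_sub P
  have hγlim : Tendsto γ atTop (nhds γs) := by
    rw [hγs, funext hγ]
    exact (((hpP.add_const 1).const_mul 2).div (hpP.sub_const 1) hP0).sub_const _
  have hρlim := tendsto_inflection hlam hlL hc hU hε hε0 hp hv hvR
  have hRlim := eventually_lt_radius hlam hlL hc hU hε hε0 hp hv hvR
  -- the total exponent of the tail stays below `-N`
  obtain ⟨s, hNs, hs⟩ : ∃ s : ℝ, (N : ℝ) < s ∧ γs - b * (P + 1) < -s := by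
    have h1 : γs - b * (P + 1) < -N := by
      have h2 : 2 * (P + 1) / (P - 1) = 2 / (P - 1) * (P + 1) := by ring
      have h3 : 2 / (P - 1) * (P + 1) < b * (P + 1) := by gcongr
      rw [hγs, h2]
      linarith
    obtain ⟨s, h2, h3⟩ := exists_between h1
    exact ⟨-s, by linarith, by linarith⟩
  have hs0 : 0 < s := (Nat.cast_nonneg N).trans_lt hNs
  have hexp : ∀ᶠ n in atTop, γ n - b * (P - ε n + 1) < -s :=
    (hγlim.sub ((hpP.add_const 1).const_mul b)).eventually_lt_const hs
  obtain ⟨A, hA⟩ : ∃ A, A = exp ((|log (R0 / 2)| + |log S|) * (|γs| + 1)) * (1 + S) ^ s :=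
    ⟨_, rfl⟩
  obtain ⟨B, hB⟩ : ∃ B, B = S ^ (b * (P + 1)) * 2 ^ s := ⟨_, rfl⟩
  have hA0 : 0 < A := by rw [hA]; positivity
  have hB0 : 0 < B := by rw [hB]; positivity
  let F : ℕ → EuclideanSpace ℝ (Fin N) → ℝ := fun n =>
    (Metric.ball (0 : EuclideanSpace ℝ (Fin N)) (R n)).indicator
      (fun x => v n ‖x‖ ^ (P - ε n + 1) * max (ρ n) ‖x‖ ^ γ n)
  let bound : EuclideanSpace ℝ (Fin N) → ℝ := fun x => (A + B) * (1 + ‖x‖) ^ (-s)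
  have hbound_int : Integrable bound :=
    (integrable_one_add_norm (by rw [finrank_euclideanSpace_fin]; exact hNs)).const_mul (A + B)
  have hmeas : ∀ n, AEStronglyMeasurable (F n) := fun n => by
    refine (aestronglyMeasurable_indicator_iff Metric.isOpen_ball.measurableSet).2
      (ContinuousOn.aestronglyMeasurable ?_ Metric.isOpen_ball.measurableSet)
    refine ContinuousOn.mul (ContinuousOn.rpow_const ?_ fun x _ => Or.inr ?_)
      (ContinuousOn.rpow_const (by fun_prop) fun x _ => Or.inl ?_)
    · exact (hv n).cont.comp continuous_norm.continuousOn fun x hx =>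
        ⟨norm_nonneg x, (mem_ball_zero_iff.1 hx).le⟩
    · linarith [hp n]
    · exact ((hv n).rho_pos.trans_le (le_max_left _ _)).ne'
  have hdom : ∀ᶠ n in atTop, ∀ x, ‖F n x‖ ≤ bound x := by
    filter_upwards [hdecay, hexp, hRlim S, hρlim.eventually_lt_const hSR,
      hρlim.eventually_const_lt (half_lt_self hR0),
      hγlim.abs.eventually_lt_const (lt_add_one _)] with n h1 h2 h3 h4 h5 h6 x
    have hbx : 0 ≤ bound x := by positivity
    by_cases hx : x ∈ Metric.ball (0 : EuclideanSpace ℝ (Fin N)) (R n)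
    swap
    · rw [show F n x = 0 from indicator_of_notMem hx _, norm_zero]
      exact hbx
    rw [show F n x = v n ‖x‖ ^ (P - ε n + 1) * max (ρ n) ‖x‖ ^ γ n from indicator_of_mem hx _]
    have hxR := mem_ball_zero_iff.1 hx
    have hvx := (hv n).pos ‖x‖ ⟨norm_nonneg x, hxR⟩
    have hmax : 0 < max (ρ n) ‖x‖ := (hv n).rho_pos.trans_le (le_max_left _ _)
    have hpn : 0 ≤ P - ε n + 1 := by linarith [hp n]
    rw [norm_of_nonneg (by positivity)]
    have hx1 : 0 < 1 + ‖x‖ := by positivity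
    have hx1s : 0 < (1 + ‖x‖) ^ (-s) := by positivity
    rcases lt_or_ge ‖x‖ S with hxS | hxS
    · have g1 : v n ‖x‖ ^ (P - ε n + 1) ≤ 1 :=
        rpow_le_one hvx.le ((hv n).le_one ⟨norm_nonneg x, hxR⟩) hpn
      have g2 := rpow_le_exp_of_mem_Icc (half_pos hR0)
        (show max (ρ n) ‖x‖ ∈ Icc (R0 / 2) S from
          ⟨h5.le.trans (le_max_left _ _), max_le h4.le hxS.le⟩) h6.le
      have g3 : 1 ≤ (1 + S) ^ s * (1 + ‖x‖) ^ (-s) := by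
        rw [rpow_neg hx1.le, ← div_eq_mul_inv, one_le_div (by positivity)]
        gcongr
      calc _ ≤ 1 * exp ((|log (R0 / 2)| + |log S|) * (|γs| + 1)) := by gcongr
        _ ≤ exp ((|log (R0 / 2)| + |log S|) * (|γs| + 1)) *
            ((1 + S) ^ s * (1 + ‖x‖) ^ (-s)) := by
          rw [one_mul]; exact le_mul_of_one_le_right (exp_pos _).le g3
        _ = A * (1 + ‖x‖) ^ (-s) := by rw [hA]; ring
        _ ≤ (A + B) * (1 + ‖x‖) ^ (-s) := by gcongr; linarith
    · have hx0 : 0 < ‖x‖ := hS0.trans_le hxS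
      rw [max_eq_right (h4.le.trans hxS)]
      calc v n ‖x‖ ^ (P - ε n + 1) * ‖x‖ ^ γ n
          ≤ (S ^ b * ‖x‖ ^ (-b)) ^ (P - ε n + 1) * ‖x‖ ^ γ n := by
            gcongr
            exact h1 _ ⟨hxS, hxR⟩
        _ = S ^ (b * (P - ε n + 1)) * ‖x‖ ^ (γ n - b * (P - ε n + 1)) := by
            rw [mul_rpow (by positivity) (by positivity), ← rpow_mul hS0.le, ← rpow_mul hx0.le,
              mul_assoc, ← rpow_add hx0]
            congr 2
            ring
        _ ≤ S ^ (b * (P + 1)) * ‖x‖ ^ (-s) := by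
            gcongr
            · linarith [hε n]
            · linarith
        _ ≤ S ^ (b * (P + 1)) * (2 ^ s * (1 + ‖x‖) ^ (-s)) := by
            gcongr
            rw [rpow_neg hx0.le, rpow_neg hx1.le, ← div_eq_mul_inv, le_div_iff₀ (by positivity),
              inv_mul_eq_div, ← div_rpow hx1.le hx0.le]
            gcongr
            rw [div_le_iff₀ hx0]
            linarith
        _ = B * (1 + ‖x‖) ^ (-s) := by rw [hB]; ring
        _ ≤ (A + B) * (1 + ‖x‖) ^ (-s) := by gcongr; linarith
  have hlim : ∀ x, Tendsto (fun n => F n x) atTop (nhds (U ‖x‖ ^ (P + 1) * max R0 ‖x‖ ^ γs)) := by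
    intro x
    have hUx := (hU (max R0 ‖x‖ + 1) (by linarith [le_max_left R0 ‖x‖])).pos ‖x‖
      ⟨norm_nonneg x, by linarith [le_max_right R0 ‖x‖]⟩
    have h1 := ((tendsto_profile hlam hlL hc hU hε hε0 hp hv hvR (norm_nonneg x)).1.rpow
      (hpP.add_const 1) (Or.inl hUx.ne')).mul
      ((hρlim.max (tendsto_const_nhds (x := ‖x‖))).rpow hγlim
        (Or.inl (hR0.trans_le (le_max_left _ _)).ne'))
    refine h1.congr' ?_
    filter_upwards [hRlim ‖x‖] with n hn
    simp only [F]
    rw [indicator_of_mem (mem_ball_zero_iff.2 hn)]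
  refine ⟨hbound_int.mono' (aestronglyMeasurable_of_tendsto_ae atTop hmeas (.of_forall hlim)) ?_,
    tendsto_integral_filter_of_dominated_convergence bound (.of_forall hmeas)
      (hdom.mono fun n h => .of_forall h) hbound_int (.of_forall hlim)⟩
  exact .of_forall fun x => le_of_tendsto (hlim x).norm (hdom.mono fun n h => h x)

/-- Energy invariance in the concentration limit: the weighted energy of `U` is finite
and the weighted energies of `uₙ` over the unit ball converge to it. -/
theorem stmt_15 (lam Lam : ℝ) (N : ℕ) (Ntil pstar c1 R0 : ℝ)
    (hlam : 0 < lam) (hlL : lam ≤ Lam) (hN : 2 ≤ N)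
    (hNtil : Ntil = lam / Lam * ((N : ℝ) - 1) + 1) (hNtil2 : 2 < Ntil)
    (hpstar : 1 < pstar)
    (U : ℝ → ℝ) (hU : IsEntireSol lam Lam N Ntil pstar c1 R0 U)
    (hnonex : ¬ ∃ w : ℝ → ℝ, IsDirichletSol lam Lam N pstar w)
    (ε : ℕ → ℝ) (hε : ∀ n, 0 < ε n) (hε0 : Tendsto ε atTop (nhds 0))
    (hpn : ∀ n, 1 < pstar - ε n)
    (u : ℕ → ℝ → ℝ) (hu : ∀ n, IsDirichletSol lam Lam N (pstar - ε n) (u n))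
    (r0 : ℕ → ℝ) (hr0 : ∀ n, InflectionAt (u n) (r0 n))
    (γn : ℕ → ℝ)
    (hγn : ∀ n, γn n = 2 * (pstar - ε n + 1) / (pstar - ε n - 1) - N)
    (gn : ℕ → EuclideanSpace ℝ (Fin N) → ℝ)
    (hgn : ∀ n, gn n = fun x => if ‖x‖ ≤ r0 n then r0 n ^ γn n else ‖x‖ ^ γn n)
    (γs : ℝ) (hγs : γs = 2 * (pstar + 1) / (pstar - 1) - N)
    (gU : EuclideanSpace ℝ (Fin N) → ℝ)
    (hgU : gU = fun x => if ‖x‖ ≤ R0 then R0 ^ γs else ‖x‖ ^ γs) :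
    (∫⁻ x : EuclideanSpace ℝ (Fin N),
        ENNReal.ofReal (U ‖x‖ ^ (pstar + 1) * gU x)) < ⊤ ∧
    Tendsto
      (fun n => ∫ x in Metric.ball (0 : EuclideanSpace ℝ (Fin N)) 1,
        u n ‖x‖ ^ (pstar - ε n + 1) * gn n x)
      atTop
      (nhds (∫ x : EuclideanSpace ℝ (Fin N), U ‖x‖ ^ (pstar + 1) * gU x)) := by
  obtain ⟨-, -, -, -, -, -, -, -, -, -, hc1, hdec, hdec1⟩ := id hU
  have hD : lam / Lam * ((N : ℝ) - 1) = (Ntil - 2) + 1 := by linarith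
  have hM : ∀ n, 0 < u n 0 := fun n => (hu n).2.1 0 ⟨le_rfl, one_pos⟩
  obtain ⟨hint, hlim⟩ := tendsto_energy hlam hlL hN hD
    (fun R hR => hU.radialProfile hR) hε hε0 hpn
    (fun n => (hu n).radialProfile (hr0 n) rfl rfl)
    (fun n => by simp [div_self (rpow_pos_of_pos (hM n) _).ne', (hu n).2.2.1]) hc1 hdec
    (by simpa only [show Ntil - 2 + 1 = Ntil - 1 by ring] using hdec1) hγn hγs
  simp only [hgU, hgn, ite_rpow_eq_max_rpow]
  refine ⟨hint.lintegral_lt_top, hlim.congr fun n => ?_⟩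
  exact (integral_ball_rescale (hpn n) (hM n) rfl (hr0 n).1.1 (hu n).2.1 (hγn n)).symm
end

section
/- Let λ₁ < 0 < λ₂, a > 0, p > 1, T ∈ ℝ, and let δ > 0 satisfy δ^{p−1}/(λ₂·(λ₂−λ₁)·a) < 1/2 and (λ₁ + 2·δ^{p−1}/((λ₂−λ₁)·a))·p < λ₁. Then for every B > 0 there exist constants C > 0 and C' > 0, depending only on λ₁, λ₂, a, p, δ, T and B, such that the following holds: for every T* > T and every C² function x on [T,T*] satisfying x''(t) − (λ₁+λ₂)·x'(t) + λ₁·λ₂·x(t) = −x(t)^p/a on [T,T*], with 0 < x(t) ≤ δ and x'(t) ≤ 0 for all t ∈ [T,T*), x(T*) = 0, and |λ₂·x(T) − x'(T)|/(λ₂−λ₁) ≤ B, one has x(t) ≤ C·e^{λ₁ t} and |x'(t)| ≤ C'·e^{λ₁ t} for all t ∈ [T,T*]. -/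
open Real Filter Set

/-- Differential form of Gronwall's inequality: if `f' ≤ c f + e^{ct} H'`, then `e^{-ct} f - H` is
nonincreasing. -/
lemma antitoneOn_exp_neg_mul_sub {f f' H H' : ℝ → ℝ} {c u v : ℝ}
    (hf : ∀ t ∈ Icc u v, HasDerivAt f (f' t) t) (hH : ∀ t ∈ Icc u v, HasDerivAt H (H' t) t)
    (h : ∀ t ∈ Icc u v, f' t ≤ c * f t + Real.exp (c * t) * H' t) :
    AntitoneOn (fun t => Real.exp (-(c * t)) * f t - H t) (Icc u v) := by
  have hd : ∀ t ∈ Icc u v, HasDerivAt (fun t => Real.exp (-(c * t)) * f t - H t)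
      (Real.exp (-(c * t)) * (-(c * 1)) * f t + Real.exp (-(c * t)) * f' t - H' t) t :=
    fun t ht => ((((hasDerivAt_id t).const_mul c).neg.exp).mul (hf t ht)).sub (hH t ht)
  refine antitoneOn_of_deriv_nonpos (convex_Icc u v)
    (fun t ht => (hd t ht).continuousAt.continuousWithinAt)
    (fun t ht => (hd t (interior_subset ht)).differentiableAt.differentiableWithinAt) ?_
  intro t ht
  rw [(hd t (interior_subset ht)).deriv]
  have he : Real.exp (-(c * t)) * Real.exp (c * t) = 1 := by rw [← Real.exp_add]; simp
  have := mul_le_mul_of_nonneg_left (h t (interior_subset ht)) (Real.exp_pos (-(c * t))).le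
  linear_combination this + H' t * he

/-- Homogeneous case of Gronwall's inequality: if `f' ≤ c f`, then `e^{-ct} f` is nonincreasing. -/
lemma antitoneOn_exp_neg_mul {f f' : ℝ → ℝ} {c u v : ℝ}
    (hf : ∀ t ∈ Icc u v, HasDerivAt f (f' t) t) (h : ∀ t ∈ Icc u v, f' t ≤ c * f t) :
    AntitoneOn (fun t => Real.exp (-(c * t)) * f t) (Icc u v) := by
  simpa using antitoneOn_exp_neg_mul_sub (H := fun _ => 0) (H' := fun _ => 0) hf
    (fun t _ => hasDerivAt_const t 0) (by simpa using h)

/-- Uniform Gronwall-type decay estimate in Emden–Fowler variables: the constants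
`C`, `C'` depend only on `λ₁, λ₂, a, p, δ, T, B` and not on the right endpoint `T*`. -/
theorem stmt_18 (lam1 lam2 a p T δ : ℝ)
    (h1 : lam1 < 0) (h2 : 0 < lam2) (ha : 0 < a) (hp : 1 < p) (hδ : 0 < δ)
    (hδ1 : δ ^ (p - 1) / (lam2 * (lam2 - lam1) * a) < 1 / 2)
    (hδ2 : (lam1 + 2 * δ ^ (p - 1) / ((lam2 - lam1) * a)) * p < lam1) :
    ∀ B > 0, ∃ C > 0, ∃ C' > 0, ∀ Tstar : ℝ, T < Tstar →
      ∀ x x' x'' : ℝ → ℝ,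
        (∀ t ∈ Icc T Tstar, HasDerivAt x (x' t) t) →
        (∀ t ∈ Icc T Tstar, HasDerivAt x' (x'' t) t) →
        (∀ t ∈ Icc T Tstar,
          x'' t - (lam1 + lam2) * x' t + lam1 * lam2 * x t = -(x t ^ p) / a) →
        (∀ t ∈ Ico T Tstar, 0 < x t ∧ x t ≤ δ ∧ x' t ≤ 0) →
        x Tstar = 0 →
        |lam2 * x T - x' T| / (lam2 - lam1) ≤ B →
        ∀ t ∈ Icc T Tstar,
          x t ≤ C * Real.exp (lam1 * t) ∧ |x' t| ≤ C' * Real.exp (lam1 * t) := by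
  intro B hB
  have hD : 0 < lam2 - lam1 := by linarith
  obtain ⟨D, hDdef⟩ : ∃ D, D = lam2 - lam1 := ⟨_, rfl⟩
  rw [← hDdef] at hδ1 hδ2 hD ⊢
  set q := δ ^ (p - 1) with hq
  have hq0 : 0 < q := Real.rpow_pos_of_pos hδ _
  set μ := lam1 + 2 * q / (D * a) with hμ
  set K := (2 * B * Real.exp (-(μ * T))) ^ p / a with hK
  have hK0 : 0 < K := by positivity
  set s := μ * p - lam1 with hs
  have hs0 : s < 0 := by linarith
  set M := Real.exp (-(lam1 * T)) * (B * D) + K / (-s) * Real.exp (s * T) with hM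
  have hM0 : 0 < M := by
    have : 0 < -s := by linarith
    positivity
  refine ⟨M / lam2, by positivity, M, hM0, ?_⟩
  intro S hTS x x' x'' hx hx' hode hpos hxS hw
  have hx'0 : ∀ t ∈ Icc T S, x' t ≤ 0 := by
    rw [← closure_Ico hTS.ne]
    refine fun t ht => le_on_closure (f := x') (g := fun _ => 0) (fun t ht => (hpos t ht).2.2) ?_
      continuousOn_const ht
    rw [closure_Ico hTS.ne]
    exact fun t ht => (hx' t ht).continuousAt.continuousWithinAt
  have hx0 : ∀ t ∈ Icc T S, 0 ≤ x t ∧ x t ^ p ≤ q * x t := by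
    intro t ht
    rcases ht.2.eq_or_lt with rfl | hlt
    · rw [hxS, Real.zero_rpow (by linarith)]; simp
    · obtain ⟨h0, hle, -⟩ := hpos t ⟨ht.1, hlt⟩
      refine ⟨h0.le, ?_⟩
      have : x t ^ p = x t ^ (p - 1) * x t := by
        rw [← Real.rpow_add_one h0.ne']; ring_nf
      rw [this]
      exact mul_le_mul_of_nonneg_right
        (Real.rpow_le_rpow h0.le hle (by linarith)) h0.le
  have hTm : T ∈ Icc T S := ⟨le_rfl, hTS.le⟩
  have hSm : S ∈ Icc T S := ⟨hTS.le, le_rfl⟩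
  have hxpa : ∀ t ∈ Icc T S, x t ^ p / a ≤ q / a * x t := by
    intro t ht
    rw [div_mul_eq_mul_div]
    exact div_le_div_of_nonneg_right (hx0 t ht).2 ha.le
  have hxw : ∀ t ∈ Icc T S, x t ≤ 2 / D * (lam2 * x t - x' t) := by
    intro t ht
    set k := q / (lam2 * a) with hk
    have hk0 : 0 < k := by positivity
    have hkq : lam2 * k = q / a := by rw [hk]; field_simp
    have hanti := antitoneOn_exp_neg_mul (c := lam2) (u := T) (v := S)
      (f := fun t => k * x t - (x' t - lam1 * x t))
      (f' := fun t => k * x' t - (x'' t - lam1 * x' t))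
      (fun t ht => ((hx t ht).const_mul k).sub ((hx' t ht).sub ((hx t ht).const_mul lam1)))
      (by
        intro t ht
        have e := hode t ht
        rw [neg_div] at e
        have e1 := hxpa t ht
        have e2 := mul_nonpos_of_nonneg_of_nonpos hk0.le (hx'0 t ht)
        rw [← hkq] at e1
        linear_combination e1 + e2 - e)
    have h3 := hanti ht hSm ht.2
    simp only [hxS] at h3
    have h4 : 0 ≤ Real.exp (-(lam2 * S)) * (k * 0 - (x' S - lam1 * 0)) :=
      mul_nonneg (Real.exp_pos _).le (by linarith [hx'0 S hSm])
    have h5 := nonneg_of_mul_nonneg_right (h4.trans h3) (Real.exp_pos _)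
    have h6 : k ≤ D / 2 := by
      have : q / (lam2 * D * a) = k / D := by rw [hk]; field_simp
      rw [this, div_lt_iff₀ hD] at hδ1
      linarith
    have h7 := mul_le_mul_of_nonneg_right h6 (hx0 t ht).1
    rw [div_mul_eq_mul_div, le_div_iff₀ hD]
    rw [hDdef] at h7 ⊢
    linarith
  have hwd : ∀ t ∈ Icc T S, HasDerivAt (fun t => lam2 * x t - x' t) (lam2 * x' t - x'' t) t :=
    fun t ht => ((hx t ht).const_mul lam2).sub (hx' t ht)
  have hode' : ∀ t ∈ Icc T S,
      lam2 * x' t - x'' t = lam1 * (lam2 * x t - x' t) + x t ^ p / a := by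
    intro t ht
    have e := hode t ht
    rw [neg_div] at e
    linear_combination -e
  have hwT : lam2 * x T - x' T ≤ B * D := by
    rw [div_le_iff₀ hD] at hw
    exact (le_abs_self _).trans hw
  have hwμ : ∀ t ∈ Icc T S, x t ≤ 2 * B * Real.exp (-(μ * T)) * Real.exp (μ * t) := by
    intro t ht
    have hanti := antitoneOn_exp_neg_mul (c := μ) hwd (by
      intro t ht
      rw [hode' t ht]
      have e1 := hxpa t ht
      have e2 := mul_le_mul_of_nonneg_left (hxw t ht) (div_pos hq0 ha).le
      have e3 : μ * (lam2 * x t - x' t)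
          = lam1 * (lam2 * x t - x' t) + q / a * (2 / D * (lam2 * x t - x' t)) := by
        rw [hμ]; field_simp
      linarith)
    have h3 := hanti hTm ht ht.1
    have h4 := h3.trans (mul_le_mul_of_nonneg_left hwT (Real.exp_pos _).le)
    simp only [Real.exp_neg (μ * t), inv_mul_le_iff₀ (Real.exp_pos (μ * t))] at h4
    refine (hxw t ht).trans ((mul_le_mul_of_nonneg_left h4 (by positivity)).trans_eq ?_)
    field_simp
  have hwM : ∀ t ∈ Icc T S, lam2 * x t - x' t ≤ M * Real.exp (lam1 * t) := by
    intro t ht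
    have hanti := antitoneOn_exp_neg_mul_sub (c := lam1) (H := fun t => K / s * Real.exp (s * t))
      (H' := fun t => K * Real.exp (s * t)) hwd
      (by
        intro t _
        refine ((((hasDerivAt_id t).const_mul s).exp).const_mul (K / s)).congr_deriv ?_
        have := hs0.ne
        simp only [id, mul_one]
        field_simp)
      (by
        intro t ht
        rw [hode' t ht]
        have e1 := Real.rpow_le_rpow (hx0 t ht).1 (hwμ t ht) (by linarith : 0 ≤ p)
        rw [Real.mul_rpow (by positivity) (Real.exp_pos _).le, ← Real.exp_mul] at e1
        have e2 := div_le_div_of_nonneg_right e1 ha.le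
        have e3 : Real.exp (μ * t * p) = Real.exp (lam1 * t) * Real.exp (s * t) := by
          rw [← Real.exp_add, hs]; ring_nf
        rw [e3] at e2
        refine add_le_add_right (e2.trans_eq ?_) _
        rw [hK]; ring)
    have h3 := hanti hTm ht ht.1
    have h4 := mul_le_mul_of_nonneg_left hwT (Real.exp_pos (-(lam1 * T))).le
    have h5 : K / s * Real.exp (s * t) ≤ 0 :=
      mul_nonpos_of_nonpos_of_nonneg (div_nonpos_of_nonneg_of_nonpos hK0.le hs0.le)
        (Real.exp_pos _).le
    have h6 : Real.exp (-(lam1 * t)) * (lam2 * x t - x' t) ≤ M := by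
      rw [hM, div_neg]
      simp only at h3
      linarith
    rwa [Real.exp_neg, inv_mul_le_iff₀ (Real.exp_pos _), mul_comm _ M] at h6
  intro t ht
  have h3 := hwM t ht
  have h4 := hx'0 t ht
  have h5 := mul_nonneg h2.le (hx0 t ht).1
  constructor
  · rw [div_mul_eq_mul_div, le_div_iff₀ h2]
    linarith
  · rw [abs_of_nonpos h4]
    linarith
end

section
/- Let λ₁ < 0 < λ₂, a > 0, p > 1, T ∈ ℝ, c₁ > 0. Let X be a positive C² function on [T,∞) satisfying X''(t) − (λ₁+λ₂)·X'(t) + λ₁·λ₂·X(t) = −X(t)^p/a for all t ≥ T, and suppose e^{−λ₁ t}·X(t) → c₁ as t → +∞. Set X₋ := (λ₂·X(T) − X'(T))/(λ₂−λ₁). Then the integral ∫_T^∞ X(s)^p·e^{−λ₁ s} ds converges and c₁ = X₋·e^{−λ₁ T} + (1/(a·(λ₂−λ₁)))·∫_T^∞ X(s)^p·e^{−λ₁ s} ds. -/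
open Real Filter Set MeasureTheory

/-- If `H' ≥ 0` past `T` and `exp (-d t) Y` has derivative `-exp (-d t) H`, with `Y → c`,
then `H → d c`. -/
theorem tendsto_of_hasDerivAt_exp_mul {Y H H' : ℝ → ℝ} {d T c : ℝ} (hd : 0 < d)
    (hH : ∀ t ∈ Ici T, HasDerivAt H (H' t) t) (hH' : ∀ t ∈ Ici T, 0 ≤ H' t)
    (hY : ∀ t ∈ Ici T, HasDerivAt (fun t => exp (-d * t) * Y t) (-(exp (-d * t) * H t)) t)
    (hc : Tendsto Y atTop (nhds c)) :
    Tendsto H atTop (nhds (d * c)) := by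
  have hev : ∀ᶠ t in atTop, t ∈ Ici T := Ici_mem_atTop T
  have hexp : Tendsto (fun t => exp (-d * t)) atTop (nhds 0) :=
    tendsto_exp_atBot.comp (tendsto_id.const_mul_atTop_of_neg (by linarith))
  have hmonoOn : MonotoneOn H (Ici T) := by
    refine monotoneOn_of_hasDerivWithinAt_nonneg (convex_Ici T)
      (fun t ht => (hH t ht).continuousAt.continuousWithinAt)
      (fun t ht => (hH t (interior_subset ht)).hasDerivWithinAt)
      (fun t ht => hH' t (interior_subset ht))
  have hmono : Monotone fun t => H (max T t) := fun s t hst =>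
    hmonoOn (le_max_left T s) (le_max_left T t) (max_le_max le_rfl hst)
  have hcongr : (fun t => H (max T t)) =ᶠ[atTop] H := by
    filter_upwards [hev] with t ht
    rw [max_eq_right (mem_Ici.mp ht)]
  have hlhop : ∀ l : Filter ℝ, Tendsto (fun t => H t / d) atTop l → Tendsto Y atTop l := by
    intro l hl
    have hg : ∀ t : ℝ, HasDerivAt (fun t => exp (-d * t)) (-(d * exp (-d * t))) t := fun t =>
      (((hasDerivAt_id t).const_mul (-d)).exp).congr_deriv (by simp; ring)
    have key := HasDerivAt.lhopital_zero_atTop (l := l)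
      (hev.mono hY) (Eventually.of_forall hg)
      (Eventually.of_forall fun t => neg_ne_zero.mpr (mul_pos hd (exp_pos _)).ne')
      (by simpa using hexp.mul hc) hexp
      (hl.congr fun t => by
        have := (exp_pos (-d * t)).ne'
        field_simp)
    exact key.congr fun t => mul_div_cancel_left₀ _ (exp_pos _).ne'
  rcases tendsto_atTop_of_monotone hmono with htop | ⟨L, hL⟩
  · exact absurd (hlhop _ ((htop.congr' hcongr).atTop_div_const hd))
      (not_tendsto_atTop_of_tendsto_nhds hc)
  · have hHL := hL.congr' hcongr
    have hcL : c = L / d := tendsto_nhds_unique hc (hlhop _ (hHL.div_const d))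
    rwa [hcL, mul_div_cancel₀ L hd.ne']

/-- Integral characterization of the fast-decay constant `c₁` in Emden–Fowler
variables: `c₁ = X₋ e^{−λ₁T} + (1/(a(λ₂−λ₁))) ∫_T^∞ X^p e^{−λ₁ s} ds`. -/
theorem stmt_19 (lam1 lam2 a p T c1 : ℝ)
    (h1 : lam1 < 0) (h2 : 0 < lam2) (ha : 0 < a) (hp : 1 < p) (hc1 : 0 < c1)
    (X X' X'' : ℝ → ℝ)
    (hX' : ∀ t ∈ Ici T, HasDerivAt X (X' t) t)
    (hX'' : ∀ t ∈ Ici T, HasDerivAt X' (X'' t) t)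
    (hX''c : ContinuousOn X'' (Ici T))
    (hpos : ∀ t ∈ Ici T, 0 < X t)
    (hode : ∀ t ∈ Ici T,
      X'' t - (lam1 + lam2) * X' t + lam1 * lam2 * X t = -(X t ^ p) / a)
    (hlim : Tendsto (fun t => Real.exp (-lam1 * t) * X t) atTop (nhds c1))
    (Xm : ℝ) (hXm : Xm = (lam2 * X T - X' T) / (lam2 - lam1)) :
    IntegrableOn (fun s => X s ^ p * Real.exp (-lam1 * s)) (Ioi T) ∧
    c1 = Xm * Real.exp (-lam1 * T) +
      (1 / (a * (lam2 - lam1))) * ∫ s in Ioi T, X s ^ p * Real.exp (-lam1 * s) := by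
  have hd : 0 < lam2 - lam1 := by linarith
  have hE : ∀ k t : ℝ, HasDerivAt (fun t => exp (k * t)) (k * exp (k * t)) t := fun k t =>
    (((hasDerivAt_id t).const_mul k).exp).congr_deriv (by simp; ring)
  have hG : ∀ t ∈ Ici T, HasDerivAt (fun t => exp (-lam1 * t) * (lam2 * X t - X' t))
      (X t ^ p * exp (-lam1 * t) / a) t := by
    intro t ht
    refine ((hE (-lam1) t).mul (((hX' t ht).const_mul lam2).sub (hX'' t ht))).congr_deriv ?_
    simp only [Pi.sub_apply]
    linear_combination (-exp (-lam1 * t)) * hode t ht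
  have hnonneg : ∀ t ∈ Ici T, 0 ≤ X t ^ p * exp (-lam1 * t) / a := fun t ht => by
    have := hpos t ht
    positivity
  have hexp : ∀ t, exp (-(lam2 - lam1) * t) * exp (-lam1 * t) = exp (-lam2 * t) := fun t => by
    rw [← exp_add]
    ring_nf
  have hlimG : Tendsto (fun t => exp (-lam1 * t) * (lam2 * X t - X' t)) atTop
      (nhds ((lam2 - lam1) * c1)) := by
    refine tendsto_of_hasDerivAt_exp_mul hd hG hnonneg (fun t ht => ?_) hlim
    simp only [← mul_assoc, hexp]
    refine ((hE (-lam2) t).mul (hX' t ht)).congr_deriv ?_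
    ring
  have hcont := (hG T self_mem_Ici).continuousAt.continuousWithinAt (s := Ici T)
  have hint := integrableOn_Ioi_deriv_of_nonneg hcont
    (fun t ht => hG t (Ioi_subset_Ici_self ht)) (fun t ht => hnonneg t (Ioi_subset_Ici_self ht))
    hlimG
  have hval := integral_Ioi_of_hasDerivAt_of_tendsto hcont
    (fun t ht => hG t (Ioi_subset_Ici_self ht)) hint hlimG
  rw [integral_div] at hval
  refine ⟨?_, ?_⟩
  · refine IntegrableOn.congr_fun (hint.mul_const a) (fun t _ => ?_) measurableSet_Ioi
    exact div_mul_cancel₀ _ ha.ne'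
  · rw [div_eq_iff ha.ne'] at hval
    rw [hval, hXm]
    field_simp
    ring
end
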